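/- arXiv:2109.00843 — 2 statements merged into one kernel-verified Lean document; each statement's English description precedes it below -/
import Mathlib

section
/- Let d ≥ 1 be an integer, R > 0, and let α be a real number with −d < α < 2 − d. Then for every x ∈ ℝ^d with |x| ≤ R, ∫_{B_R} |x − y|^α (R² − |y|²)^{−(α+d)/2} dy = π^{(d/2)+1} / (Γ(d/2) · sin((α+d)π/2)). In particular the value is independent of x. -/
open MeasureTheory Real

lemma aux_beta (σ : ℝ) (h0 : 0 < σ) (h1 : σ < 1) :
    ∫⁻ t in Set.Ioo (0:ℝ) 1, ENNReal.ofReal (t ^ (σ - 1) * (1 - t) ^ (-σ))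
      = ENNReal.ofReal (π / Real.sin (π * σ)) := by
  have hb : ProbabilityTheory.beta σ (1 - σ) = π / Real.sin (π * σ) := by
    rw [ProbabilityTheory.beta, ← Real.Gamma_mul_Gamma_one_sub]; simp
  have hbp := ProbabilityTheory.beta_pos h0 (sub_pos.2 h1)
  have h := ProbabilityTheory.lintegral_betaPDF_eq_one h0 (sub_pos.2 h1)
  rw [ProbabilityTheory.lintegral_betaPDF] at h
  have e : ∀ t : ℝ, ENNReal.ofReal (1 / ProbabilityTheory.beta σ (1 - σ) * t ^ (σ - 1) * (1 - t) ^ (1 - σ - 1))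
     = ENNReal.ofReal (1 / ProbabilityTheory.beta σ (1 - σ)) * ENNReal.ofReal (t ^ (σ - 1) * (1 - t) ^ (-σ)) := by
    intro t
    rw [← ENNReal.ofReal_mul (by positivity), mul_assoc]
    ring_nf
  simp_rw [e] at h
  rw [lintegral_const_mul _ (by fun_prop)] at h
  rw [← hb]
  calc _ = ENNReal.ofReal (ProbabilityTheory.beta σ (1 - σ)) * (ENNReal.ofReal (1 / ProbabilityTheory.beta σ (1 - σ)) * ∫⁻ t in Set.Ioo (0:ℝ) 1, ENNReal.ofReal (t ^ (σ - 1) * (1 - t) ^ (-σ))) := by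
        rw [← mul_assoc, ← ENNReal.ofReal_mul hbp.le, mul_one_div_cancel hbp.ne']; simp
    _ = _ := by rw [h, mul_one]

lemma aux_J (σ c p : ℝ) (hc : 0 ≤ c) (h : 0 < c ∨ p ≠ 0) :
    ∫⁻ r in {r : ℝ | 0 < r ∧ r ^ 2 + 2 * p * r < c},
        ENNReal.ofReal (r ^ (2 * σ - 1) * (c - 2 * p * r - r ^ 2) ^ (-σ))
      = ∫⁻ t in Set.Ioo (0:ℝ) 1, ENNReal.ofReal (t ^ (σ - 1) * (1 - t) ^ (-σ) *
          ((1 - t * p / √(t ^ 2 * p ^ 2 + t * c)) / 2)) := by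
  by_cases h' : 0 < c ∨ p < 0
  · have hpos : ∀ t ∈ Set.Ioo (0:ℝ) 1, 0 < t ^ 2 * p ^ 2 + t * c := by
      intro t ht
      have := ht.1
      rcases h' with h' | h'
      · positivity
      · have : p ≠ 0 := h'.ne
        positivity
    have hsq : ∀ t ∈ Set.Ioo (0:ℝ) 1, (√(t ^ 2 * p ^ 2 + t * c)) ^ 2 = t ^ 2 * p ^ 2 + t * c :=
      fun t ht => Real.sq_sqrt (hpos t ht).le
    set f : ℝ → ℝ := fun t => -t * p + √(t ^ 2 * p ^ 2 + t * c) with hf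
    have hq : ∀ t ∈ Set.Ioo (0:ℝ) 1, f t ^ 2 = t * (c - 2 * p * f t) := by
      intro t ht
      have := hsq t ht
      simp only [hf]; linear_combination this
    have hfpos : ∀ t ∈ Set.Ioo (0:ℝ) 1, 0 < f t := by
      intro t ht
      have h1 := hsq t ht
      have h0 := Real.sqrt_pos.2 (hpos t ht)
      have ht0 := ht.1
      simp only [hf]
      rcases h' with h' | h'
      · by_contra hcon
        have : 0 < t * c := by positivity
        nlinarith
      · nlinarith
    have hcp : ∀ t ∈ Set.Ioo (0:ℝ) 1, 0 < c - 2 * p * f t := by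
      intro t ht
      have := hq t ht
      have h2 : 0 < f t ^ 2 := pow_pos (hfpos t ht) 2
      rw [this] at h2
      exact pos_of_mul_pos_right h2 ht.1.le
    have himg : {r : ℝ | 0 < r ∧ r ^ 2 + 2 * p * r < c} = f '' Set.Ioo (0:ℝ) 1 := by
      ext r
      constructor
      · rintro ⟨hr, hrc⟩
        have hk : 0 < c - 2 * p * r := by nlinarith
        have ht : r ^ 2 / (c - 2 * p * r) ∈ Set.Ioo (0:ℝ) 1 :=
          ⟨by positivity, by rw [div_lt_one hk]; linarith⟩
        refine ⟨_, ht, ?_⟩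
        simp only [hf]
        set t := r ^ 2 / (c - 2 * p * r) with htd
        have htr : t * (c - 2 * p * r) = r ^ 2 := div_mul_cancel₀ _ hk.ne'
        have e : t ^ 2 * p ^ 2 + t * c = (r + t * p) ^ 2 := by linear_combination htr
        have h3 : 0 ≤ r + t * p := by
          have : (r + t * p) * (c - 2 * p * r) = r * (c - p * r) := by linear_combination p * htr
          have h4 : 0 < c - p * r := by linarith
          have h5 : 0 < (r + t * p) * (c - 2 * p * r) := by rw [this]; positivity
          exact (pos_of_mul_pos_left h5 hk.le).le
        rw [e, Real.sqrt_sq h3]; ring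
      · rintro ⟨t, ht, rfl⟩
        refine ⟨hfpos t ht, ?_⟩
        have := hq t ht
        have := hcp t ht
        nlinarith [ht.1, ht.2]
    have hinj : Set.InjOn f (Set.Ioo (0:ℝ) 1) := by
      intro t ht u hu htu
      have h1 := hq t ht
      have h2 := hq u hu
      rw [← htu, h1] at h2
      exact mul_right_cancel₀ (hcp t ht).ne' h2
    have hder : ∀ t ∈ Set.Ioo (0:ℝ) 1, HasDerivWithinAt f
        (f t ^ 2 / (2 * √(t ^ 2 * p ^ 2 + t * c) * t)) (Set.Ioo (0:ℝ) 1) t := by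
      intro t ht
      have h0 := Real.sqrt_pos.2 (hpos t ht)
      have ht0 := ht.1
      have h1 : HasDerivAt (fun t : ℝ => t ^ 2 * p ^ 2 + t * c) (2 * t * p ^ 2 + c) t := by
        have := ((hasDerivAt_pow 2 t).mul_const (p ^ 2)).add ((hasDerivAt_id t).mul_const c)
        refine this.congr_deriv ?_
        push_cast; ring
      have h2 := ((hasDerivAt_id t).neg.mul_const p).add (h1.sqrt (hpos t ht).ne')
      refine HasDerivAt.hasDerivWithinAt ?_
      refine h2.congr_deriv ?_
      rw [hq t ht]
      simp only [hf]
      set q := √(t ^ 2 * p ^ 2 + t * c) with hqd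
      field_simp
      ring
    rw [himg, lintegral_image_eq_lintegral_abs_deriv_mul measurableSet_Ioo hder hinj]
    refine setLIntegral_congr_fun measurableSet_Ioo ?_
    intro t ht
    have h0 := Real.sqrt_pos.2 (hpos t ht)
    have ht0 := ht.1
    have ht1 : 0 < 1 - t := sub_pos.2 ht.2
    have hfp := hfpos t ht
    simp only []
    rw [abs_of_nonneg (by positivity), ← ENNReal.ofReal_mul (by positivity)]
    congr 1
    have e1 : c - 2 * p * f t - f t ^ 2 = f t ^ 2 * ((1 - t) * t⁻¹) := by
      have := hq t ht
      field_simp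
      linear_combination -this
    have e2 : (1 - t * p / √(t ^ 2 * p ^ 2 + t * c)) / 2 = f t / (2 * √(t ^ 2 * p ^ 2 + t * c)) := by
      simp only [hf]
      rw [div_eq_div_iff (by norm_num) (by positivity)]
      have : t * p / √(t ^ 2 * p ^ 2 + t * c) * √(t ^ 2 * p ^ 2 + t * c) = t * p := div_mul_cancel₀ _ h0.ne'
      linear_combination -2 * this
    rw [e1, e2, Real.mul_rpow (by positivity) (by positivity), Real.mul_rpow (by positivity) (by positivity),
      Real.inv_rpow ht0.le, Real.rpow_neg ht0.le, inv_inv, ← Real.rpow_natCast (f t) 2, ← Real.rpow_mul hfp.le,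
      Real.rpow_sub hfp, Real.rpow_sub ht0, Real.rpow_one, Real.rpow_one]
    have e3 : f t ^ (((2:ℕ):ℝ) * -σ) = (f t ^ (2 * σ))⁻¹ := by
      rw [← Real.rpow_neg hfp.le]; congr 1; push_cast; ring
    rw [e3]
    have : 0 < f t ^ (2 * σ) := by positivity
    rw [show f t ^ ((2:ℕ):ℝ) = f t ^ 2 by norm_cast]
    field_simp
  · push Not at h'
    have hc0 : c = 0 := le_antisymm h'.1 hc
    have hp : 0 < p := lt_of_le_of_ne h'.2 (by rcases h with h | h; · linarith
                                               · exact h.symm)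
    have : {r : ℝ | 0 < r ∧ r ^ 2 + 2 * p * r < c} = ∅ := by
      ext r; simp only [Set.mem_ofPred_eq, Set.mem_empty_iff_false, iff_false]
      rintro ⟨h1, h2⟩
      have : 0 < r ^ 2 + 2 * p * r := by positivity
      linarith
    rw [this]
    simp only [Measure.restrict_empty, lintegral_zero_measure]
    symm
    rw [← lintegral_zero (μ := volume.restrict (Set.Ioo (0:ℝ) 1))]
    refine setLIntegral_congr_fun measurableSet_Ioo ?_
    intro t ht
    have ht0 := ht.1
    have : √(t ^ 2 * p ^ 2 + t * c) = t * p := by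
      rw [hc0, mul_zero, add_zero, ← mul_pow, Real.sqrt_sq (by positivity)]
    simp only [this]
    rw [div_self (by positivity)]; simp

lemma aux_sum (σ c p : ℝ) (h0 : 0 < σ) (h1 : σ < 1) (hc : 0 ≤ c) (h : 0 < c ∨ p ≠ 0) :
    (∫⁻ r in {r : ℝ | 0 < r ∧ r ^ 2 + 2 * p * r < c},
        ENNReal.ofReal (r ^ (2 * σ - 1) * (c - 2 * p * r - r ^ 2) ^ (-σ))) +
    ∫⁻ r in {r : ℝ | 0 < r ∧ r ^ 2 + 2 * (-p) * r < c},
        ENNReal.ofReal (r ^ (2 * σ - 1) * (c - 2 * (-p) * r - r ^ 2) ^ (-σ))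
      = ENNReal.ofReal (π / Real.sin (π * σ)) := by
  rw [aux_J σ c p hc h, aux_J σ c (-p) hc (by simpa using h), ← aux_beta σ h0 h1,
    ← lintegral_add_left (by fun_prop)]
  refine setLIntegral_congr_fun measurableSet_Ioo ?_
  intro t ht
  have ht0 := ht.1
  have ht1 : 0 < 1 - t := sub_pos.2 ht.2
  have hle : |t * p / √(t ^ 2 * p ^ 2 + t * c)| ≤ 1 := by
    rw [abs_div, abs_of_nonneg (Real.sqrt_nonneg _)]
    refine div_le_one_of_le₀ ?_ (Real.sqrt_nonneg _)
    refine Real.abs_le_sqrt ?_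
    have : 0 ≤ t * c := by positivity
    nlinarith
  have := abs_le.1 hle
  simp only [neg_sq, mul_neg, neg_div]
  rw [← ENNReal.ofReal_add]
  · congr 1; ring
  · exact mul_nonneg (by positivity) (by linarith)
  · exact mul_nonneg (by positivity) (by linarith)

lemma aux_polar {E : Type*} [NormedAddCommGroup E] [NormedSpace ℝ E] [MeasurableSpace E] [BorelSpace E]
    [FiniteDimensional ℝ E] [Nontrivial E] (μ : Measure E) [μ.IsAddHaarMeasure] (f : E → ENNReal) (hf : Measurable f) :
    ∫⁻ z, f z ∂μ = ∫⁻ θ : Metric.sphere (0:E) 1, (∫⁻ r in Set.Ioi (0:ℝ),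
      ENNReal.ofReal (r ^ (Module.finrank ℝ E - 1)) * f (r • (θ : E))) ∂μ.toSphere := by
  have h := (μ.measurePreserving_homeomorphUnitSphereProd).symm
    (homeomorphUnitSphereProd E).toMeasurableEquiv
  have h2 := h.lintegral_comp (f := fun z => f z) (hf.comp measurable_subtype_coe)
  rw [lintegral_subtype_comap (measurableSet_singleton _).compl,
    restrict_compl_singleton] at h2
  rw [← h2, lintegral_prod]
  · refine lintegral_congr fun θ => ?_
    rw [Measure.volumeIoiPow, lintegral_withDensity_eq_lintegral_mul]
    · rw [← lintegral_subtype_comap measurableSet_Ioi]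
      rfl
    · fun_prop
    · exact hf.comp (measurable_subtype_coe.comp
        ((MeasurableEquiv.measurable _).comp (measurable_const.prodMk measurable_id)))
  · exact (hf.comp (measurable_subtype_coe.comp (MeasurableEquiv.measurable _))).aemeasurable

lemma aux_null {E : Type*} [NormedAddCommGroup E] [InnerProductSpace ℝ E] [MeasurableSpace E] [BorelSpace E]
    [FiniteDimensional ℝ E] (μ : Measure E) [μ.IsAddHaarMeasure] (x : E) (hx : x ≠ 0) :
    ∀ᵐ θ : Metric.sphere (0:E) 1 ∂μ.toSphere, inner ℝ x (θ : E) ≠ 0 := by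
  rw [ae_iff]
  simp only [not_not]
  rw [Measure.toSphere_apply']
  · have : μ ((ℝ ∙ x)ᗮ : Submodule ℝ E) = 0 := by
      refine Measure.addHaar_submodule _ _ ?_
      intro h
      have : x ∈ (ℝ ∙ x)ᗮ := by rw [h]; trivial
      rw [Submodule.mem_orthogonal_singleton_iff_inner_right] at this
      exact hx (inner_self_eq_zero.1 this)
    rw [measure_mono_null _ this, mul_zero]
    rintro _ ⟨r, hr, _, ⟨θ, hθ, rfl⟩, rfl⟩
    simp only [Set.mem_ofPred_eq] at hθ
    simp [Submodule.mem_orthogonal_singleton_iff_inner_right, inner_smul_right, hθ]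
  · exact measurableSet_eq_fun (by fun_prop) measurable_const

lemma aux_ray {E : Type*} [NormedAddCommGroup E] [InnerProductSpace ℝ E]
    (d : ℕ) (hd : 1 ≤ d) (R : ℝ) (hR : 0 < R) (α : ℝ) (x θ : E) (hθ : ‖θ‖ = 1)  :
    (∫⁻ r in Set.Ioi (0:ℝ), ENNReal.ofReal (r ^ (d - 1)) *
      ({z : E | ‖x + z‖ < R}.indicator
        (fun z => ENNReal.ofReal (‖z‖ ^ α * (R ^ 2 - ‖x + z‖ ^ 2) ^ (-(α + d) / 2))) (r • θ)))
    = ∫⁻ r in {r : ℝ | 0 < r ∧ r ^ 2 + 2 * inner ℝ x θ * r < R ^ 2 - ‖x‖ ^ 2},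
        ENNReal.ofReal (r ^ (2 * ((α + d) / 2) - 1) *
          ((R ^ 2 - ‖x‖ ^ 2) - 2 * inner ℝ x θ * r - r ^ 2) ^ (-((α + d) / 2))) := by
  have hn : ∀ r : ℝ, ‖x + r • θ‖ ^ 2 = ‖x‖ ^ 2 + 2 * inner ℝ x θ * r + r ^ 2 := by
    intro r
    rw [norm_add_sq_real, inner_smul_right, norm_smul, hθ, mul_one, Real.norm_eq_abs, sq_abs]; ring
  have hm : MeasurableSet {r : ℝ | 0 < r ∧ r ^ 2 + 2 * inner ℝ x θ * r < R ^ 2 - ‖x‖ ^ 2} := by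
    rw [Set.setOf_and]
    exact (measurableSet_lt (by fun_prop) (by fun_prop)).inter
      (measurableSet_lt (by fun_prop) (by fun_prop))
  rw [← lintegral_indicator measurableSet_Ioi, ← lintegral_indicator hm]
  refine lintegral_congr fun r => ?_
  by_cases hr : 0 < r
  · rw [Set.indicator_of_mem (by exact hr)]
    have hiff : ‖x + r • θ‖ < R ↔ r ^ 2 + 2 * inner ℝ x θ * r < R ^ 2 - ‖x‖ ^ 2 := by
      rw [← sq_lt_sq₀ (norm_nonneg _) hR.le, hn]
      constructor <;> intro h <;> linarith
    by_cases h : ‖x + r • θ‖ < R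
    · rw [Set.indicator_of_mem (by exact h), Set.indicator_of_mem (by exact ⟨hr, hiff.1 h⟩),
        ← ENNReal.ofReal_mul (by positivity), hn, norm_smul, hθ, mul_one, Real.norm_eq_abs, abs_of_pos hr,
        ← mul_assoc, ← Real.rpow_natCast, ← Real.rpow_add hr, Nat.cast_sub hd]
      congr 3
      · push_cast; ring
      · ring
      · ring
    · rw [Set.indicator_of_notMem (by exact h), Set.indicator_of_notMem, mul_zero]
      exact fun h' => h (hiff.2 h'.2)
  · rw [Set.indicator_of_notMem (by exact hr), Set.indicator_of_notMem]
    exact fun h' => hr h'.1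

lemma aux_int (d : ℕ) (hd : 1 ≤ d) (R : ℝ) (α : ℝ) (x : EuclideanSpace ℝ (Fin d)) :
    ∫ y in Metric.closedBall (0 : EuclideanSpace ℝ (Fin d)) R,
        ‖x - y‖ ^ α * (R ^ 2 - ‖y‖ ^ 2) ^ (-(α + d) / 2) = (∫⁻ z, {z : EuclideanSpace ℝ (Fin d) | ‖x + z‖ < R}.indicator
        (fun z => ENNReal.ofReal (‖z‖ ^ α * (R ^ 2 - ‖x + z‖ ^ 2) ^ (-(α + d) / 2))) z).toReal := by
  have : Nonempty (Fin d) := ⟨⟨0, hd⟩⟩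
  have : Nontrivial (EuclideanSpace ℝ (Fin d)) := by
    apply Module.nontrivial_of_finrank_pos (R := ℝ)
    simpa using (Nat.lt_of_lt_of_le Nat.zero_lt_one hd)
  have hb : Metric.ball (0 : EuclideanSpace ℝ (Fin d)) R =ᵐ[volume] Metric.closedBall 0 R :=
    ae_eq_of_subset_of_measure_ge Metric.ball_subset_closedBall
      (Measure.addHaar_closedBall_eq_addHaar_ball volume _ _).le
      measurableSet_ball.nullMeasurableSet measure_closedBall_lt_top.ne
  rw [integral_eq_lintegral_of_nonneg_ae]
  · congr 1
    rw [setLIntegral_congr hb.symm,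
      ← lintegral_indicator measurableSet_ball, ← lintegral_add_left_eq_self _ x]
    refine lintegral_congr fun z => ?_
    by_cases h : ‖x + z‖ < R
    · rw [Set.indicator_of_mem (by simpa using h), Set.indicator_of_mem (by exact h)]
      simp
    · rw [Set.indicator_of_notMem (by simpa using h), Set.indicator_of_notMem (by exact h)]
  · filter_upwards [ae_restrict_mem Metric.isClosed_closedBall.measurableSet] with y hy
    have : ‖y‖ ≤ R := by simpa using hy
    have : 0 ≤ R ^ 2 - ‖y‖ ^ 2 := by nlinarith [norm_nonneg y]
    simp only [Pi.zero_apply]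
    positivity
  · exact Measurable.aestronglyMeasurable (by fun_prop)

theorem stmt2 (d : ℕ) (hd : 1 ≤ d) (R : ℝ) (hR : 0 < R) (α : ℝ)
    (hα1 : -(d : ℝ) < α) (hα2 : α < 2 - d)
    (x : EuclideanSpace ℝ (Fin d)) (hx : ‖x‖ ≤ R) :
    ∫ y in Metric.closedBall (0 : EuclideanSpace ℝ (Fin d)) R,
        ‖x - y‖ ^ α * (R ^ 2 - ‖y‖ ^ 2) ^ (-(α + d) / 2)
      = Real.pi ^ ((d : ℝ) / 2 + 1) /
          (Real.Gamma ((d : ℝ) / 2) * Real.sin ((α + d) * Real.pi / 2)) := by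
  have : Nonempty (Fin d) := ⟨⟨0, hd⟩⟩
  have : Nontrivial (EuclideanSpace ℝ (Fin d)) := by
    apply Module.nontrivial_of_finrank_pos (R := ℝ)
    simpa using (Nat.lt_of_lt_of_le Nat.zero_lt_one hd)
  have hdpos : (0:ℝ) < d := by exact_mod_cast hd
  set g : EuclideanSpace ℝ (Fin d) → ENNReal := {z | ‖x + z‖ < R}.indicator
        (fun z => ENNReal.ofReal (‖z‖ ^ α * (R ^ 2 - ‖x + z‖ ^ 2) ^ (-(α + d) / 2))) with hg
  have hgm : Measurable g := by
    refine Measurable.indicator (by fun_prop) (measurableSet_lt (by fun_prop) (by fun_prop))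
  have hs0 : 0 < Real.sin (π * ((α + d) / 2)) :=
    Real.sin_pos_of_pos_of_lt_pi (mul_pos Real.pi_pos (by linarith)) (by nlinarith [Real.pi_pos])
  have hray : ∀ θ : Metric.sphere (0:EuclideanSpace ℝ (Fin d)) 1,
      (0 < R ^ 2 - ‖x‖ ^ 2 ∨ inner ℝ x (θ : EuclideanSpace ℝ (Fin d)) ≠ 0) →
      (∫⁻ r in Set.Ioi (0:ℝ), ENNReal.ofReal (r ^ (d - 1)) *
        (g (r • (θ : EuclideanSpace ℝ (Fin d))) + g (-(r • (θ : EuclideanSpace ℝ (Fin d))))))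
      = ENNReal.ofReal (π / Real.sin (π * ((α + d) / 2))) := by
    intro θ hθ
    have h1 : ‖(θ : EuclideanSpace ℝ (Fin d))‖ = 1 := by simp
    rw [← aux_sum ((α + d) / 2) (R ^ 2 - ‖x‖ ^ 2) (inner ℝ x (θ : EuclideanSpace ℝ (Fin d)))
      (by linarith) (by linarith) (by nlinarith [norm_nonneg x]) hθ,
      ← aux_ray d hd R hR α x θ h1, ← inner_neg_right,
      ← aux_ray d hd R hR α x (-θ) (by simp), ← lintegral_add_left]
    · refine lintegral_congr fun r => ?_
      rw [mul_add, smul_neg]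
    · refine Measurable.mul (by fun_prop) (hgm.comp (by fun_prop))
  have hae : ∀ᵐ θ : Metric.sphere (0:EuclideanSpace ℝ (Fin d)) 1 ∂(volume.toSphere),
      (0 < R ^ 2 - ‖x‖ ^ 2 ∨ inner ℝ x (θ : EuclideanSpace ℝ (Fin d)) ≠ 0) := by
    rcases hx.lt_or_eq with h | h
    · exact Filter.Eventually.of_forall fun θ => Or.inl (by nlinarith [norm_nonneg x])
    · have hx0 : x ≠ 0 := by
        rintro rfl
        simp at h; linarith
      filter_upwards [aux_null volume x hx0] with θ h using Or.inr h
  have h2 : 2 * ∫⁻ z, g z = ENNReal.ofReal (π / Real.sin (π * ((α + d) / 2))) *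
      (d * ENNReal.ofReal (√π ^ d / Real.Gamma (d / 2 + 1))) := by
    calc 2 * ∫⁻ z, g z = (∫⁻ z, g z) + ∫⁻ z, g (-z) := by
          rw [lintegral_neg_eq_self, two_mul]
      _ = ∫⁻ z, (g z + g (-z)) := by rw [lintegral_add_left hgm]
      _ = _ := by
          rw [aux_polar volume (fun z => g z + g (-z)) (hgm.add (hgm.comp measurable_neg))]
          simp only [finrank_euclideanSpace_fin]
          rw [lintegral_congr_ae (hae.mono hray), lintegral_const, Measure.toSphere_apply_univ,
            EuclideanSpace.volume_ball]
          simp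
  have h3 := aux_int d hd R α x
  rw [← hg] at h3
  have h4 := congrArg ENNReal.toReal h2
  have hG : 0 < Real.Gamma ((d:ℝ) / 2) := Real.Gamma_pos_of_pos (by positivity)
  rw [Real.Gamma_add_one (by positivity)] at h4
  rw [ENNReal.toReal_mul, ENNReal.toReal_mul, ENNReal.toReal_mul, ENNReal.toReal_ofReal (by positivity),
    ENNReal.toReal_ofReal (by positivity), ← h3] at h4
  simp only [ENNReal.toReal_ofNat, ENNReal.toReal_natCast] at h4
  have h5 : √π ^ d = π ^ ((d:ℝ) / 2) := by
    rw [Real.sqrt_eq_rpow, ← Real.rpow_natCast, ← Real.rpow_mul Real.pi_pos.le]; congr 1; ring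
  rw [h5] at h4
  rw [Real.rpow_add Real.pi_pos, Real.rpow_one, show (α + d) * π / 2 = π * ((α + d) / 2) by ring]
  refine mul_left_cancel₀ (two_ne_zero) (h4.trans ?_)
  field_simp
end

section
/- Let d ≥ 1 be an integer, R > 0, ℓ a real number, and α a real number with −d < α < 2 + 2ℓ − d. Then for every x ∈ ℝ^d with |x| < R, ∫_{B_R} |x − y|^α (R² − |y|²)^{ℓ − (α+d)/2} dy = (π^{d/2} R^{2ℓ}/Γ(d/2)) · B((α+d)/2, (2ℓ+2−α−d)/2) · ₂F₁(−α/2, −ℓ; d/2; |x|²/R²). If in addition ℓ ∈ ℕ, the hypergeometric series terminates, the right-hand side is a polynomial of degree 2ℓ in |x|, and the identity holds for all |x| ≤ R. -/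
open MeasureTheory Real

/-- The Beta function `B(x,y) = Γ(x)Γ(y)/Γ(x+y)`. -/
noncomputable def realBeta (x y : ℝ) : ℝ := Real.Gamma x * Real.Gamma y / Real.Gamma (x + y)

/-- The Gaussian hypergeometric function `₂F₁(a,b;c;z)` as a series. -/
noncomputable def hyp2F1 (a b c z : ℝ) : ℝ :=
  ∑' k : ℕ, ((ascPochhammer ℝ k).eval a * (ascPochhammer ℝ k).eval b) /
    ((ascPochhammer ℝ k).eval c * (Nat.factorial k : ℝ)) * z ^ k

/-- Pochhammer symbol -/
noncomputable def poch (a : ℝ) (k : ℕ) : ℝ := (ascPochhammer ℝ k).eval a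

lemma poch_zero (a : ℝ) : poch a 0 = 1 := by simp [poch]

lemma poch_succ (a : ℝ) (k : ℕ) : poch a (k+1) = poch a k * (a + k) := by
  simp [poch, ascPochhammer_succ_eval]

lemma poch_succ_left (a : ℝ) (k : ℕ) : poch a (k+1) = a * poch (a+1) k := by
  simp [poch, ascPochhammer_succ_left]

lemma poch_add (a : ℝ) (m n : ℕ) : poch a (m+n) = poch a m * poch (a+m) n := by
  induction n with
  | zero => simp [poch_zero]
  | succ n ih => rw [← add_assoc, poch_succ, ih, poch_succ]; push_cast; ring

lemma poch_pos {a : ℝ} (ha : 0 < a) (k : ℕ) : 0 < poch a k := by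
  induction k with
  | zero => simp [poch_zero]
  | succ n ih => rw [poch_succ]; positivity

lemma poch_one (k : ℕ) : poch 1 k = (k.factorial : ℝ) := by simp [poch]

lemma poch_neg_self (k : ℕ) : poch (-(k:ℝ)) (k+1) = 0 := by
  rw [poch_succ]; simp

lemma poch_neg_of_gt {l k : ℕ} (h : l < k) : poch (-(l:ℝ)) k = 0 := by
  obtain ⟨m, rfl⟩ := Nat.exists_eq_add_of_lt h
  rw [show l + m + 1 = (l+1) + m by ring, poch_add, poch_neg_self, zero_mul]

lemma Gamma_add_nat {a : ℝ} (ha : 0 < a) (k : ℕ) :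
    Real.Gamma (a + k) = poch a k * Real.Gamma a := by
  induction k with
  | zero => simp [poch_zero]
  | succ n ih =>
    rw [poch_succ]; push_cast
    rw [← add_assoc, Real.Gamma_add_one (by positivity), ih]; ring

/-- Chu-Vandermonde, first form -/
lemma vand1 (k : ℕ) : ∀ (b c : ℝ), 0 < c →
    ∑ j ∈ Finset.range (k+1), (-1:ℝ)^j * (k.choose j) * poch b j / poch c j
      = poch (c-b) k / poch c k := by
  induction k with
  | zero => intro b c hc; simp [poch_zero]
  | succ k ih =>
    intro b c hc
    have h1 := ih b c hc
    have h2 := ih (b+1) (c+1) (by linarith)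
    have key : ∑ j ∈ Finset.range (k+1+1), (-1:ℝ)^j * ((k+1).choose j) * poch b j / poch c j
      = ∑ j ∈ Finset.range (k+1), (-1:ℝ)^j * (k.choose j) * poch b j / poch c j
        - (b/c) * ∑ j ∈ Finset.range (k+1), (-1:ℝ)^j * (k.choose j) * poch (b+1) j / poch (c+1) j := by
      rw [Finset.sum_range_succ' _ (k+1)]
      have h3 : ∑ j ∈ Finset.range (k+1), (-1:ℝ)^j * (k.choose j) * poch b j / poch c j
        = ∑ j ∈ Finset.range (k+1), (-1:ℝ)^(j+1) * (k.choose (j+1)) * poch b (j+1) / poch c (j+1)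
          + (-1:ℝ)^0 * (k.choose 0) * poch b 0 / poch c 0 := by
        rw [← Finset.sum_range_succ' (fun j => (-1:ℝ)^j * (k.choose j) * poch b j / poch c j)]
        rw [Finset.sum_range_succ _ (k+1)]
        simp
      rw [h3, Finset.mul_sum, add_sub_right_comm, ← Finset.sum_sub_distrib]
      simp only [Nat.choose_zero_right]
      congr 1
      apply Finset.sum_congr rfl
      intro j _
      rw [Nat.choose_succ_succ, poch_succ_left b, poch_succ_left c]
      have := (poch_pos (a := c+1) (by linarith) j).ne'
      push_cast
      field_simp
      ring
    rw [key, h1, h2, show c + 1 - (b+1) = c - b by ring]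
    have e1 := (poch_pos hc k).ne'
    have e2 := (poch_pos (a := c+1) (by linarith) k).ne'
    have e3 : c * poch (c+1) k = poch c k * (c + k) := by
      rw [← poch_succ_left, poch_succ]
    have e4 : (c + k : ℝ) ≠ 0 := by positivity
    rw [poch_succ c, poch_succ (c-b)]
    have e5 : b / c * (poch (c-b) k / poch (c+1) k) = b * poch (c-b) k / (poch c k * (c+k)) := by
      rw [← e3]; field_simp
    rw [e5]
    field_simp
    ring

/-- Chu-Vandermonde, convolution form -/
lemma vand2 (n : ℕ) : ∀ (x y : ℝ),
    ∑ p ∈ Finset.HasAntidiagonal.antidiagonal n, poch x p.1 / p.1.factorial * (poch y p.2 / p.2.factorial)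
      = poch (x+y) n / n.factorial := by
  induction n with
  | zero => intro x y; simp [poch_zero]
  | succ n ih =>
    intro x y
    have hn : ((n:ℝ)+1) ≠ 0 := by positivity
    have h1 := ih (x+1) y
    have h2 := ih x (y+1)
    have A : ∀ (z : ℝ) (m : ℕ), ((m+1 : ℕ):ℝ) * (poch z (m+1) / (m+1).factorial) = z * (poch (z+1) m / m.factorial) := by
      intro z m
      rw [poch_succ_left, Nat.factorial_succ]; push_cast; field_simp
    have key : ((n:ℝ)+1) * ∑ p ∈ Finset.HasAntidiagonal.antidiagonal (n+1), poch x p.1 / p.1.factorial * (poch y p.2 / p.2.factorial)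
       = x * (∑ p ∈ Finset.HasAntidiagonal.antidiagonal n, poch (x+1) p.1 / p.1.factorial * (poch y p.2 / p.2.factorial))
        + y * (∑ p ∈ Finset.HasAntidiagonal.antidiagonal n, poch x p.1 / p.1.factorial * (poch (y+1) p.2 / p.2.factorial)) := by
      have : ((n:ℝ)+1) * ∑ p ∈ Finset.HasAntidiagonal.antidiagonal (n+1), poch x p.1 / p.1.factorial * (poch y p.2 / p.2.factorial)
        = ∑ p ∈ Finset.HasAntidiagonal.antidiagonal (n+1), (p.1:ℝ) * (poch x p.1 / p.1.factorial) * (poch y p.2 / p.2.factorial)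
         + ∑ p ∈ Finset.HasAntidiagonal.antidiagonal (n+1), poch x p.1 / p.1.factorial * ((p.2:ℝ) * (poch y p.2 / p.2.factorial)) := by
        rw [← Finset.sum_add_distrib, Finset.mul_sum]
        apply Finset.sum_congr rfl
        intro p hp
        have := Finset.HasAntidiagonal.mem_antidiagonal.1 hp
        have h : ((n:ℝ)+1) = p.1 + p.2 := by exact_mod_cast this.symm
        rw [h]; ring
      rw [this, Finset.Nat.sum_antidiagonal_succ, Finset.Nat.sum_antidiagonal_succ' (f := fun p => poch x p.1 / p.1.factorial * ((p.2:ℝ) * (poch y p.2 / p.2.factorial)))]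
      simp only [A]
      rw [Finset.mul_sum, Finset.mul_sum]
      simp only [Nat.cast_zero, zero_mul, mul_zero, zero_add]
      congr 1 <;> (apply Finset.sum_congr rfl; intro p _; ring)
    rw [h1, h2] at key
    have : ((n:ℝ)+1) * (poch (x+y) (n+1) / (n+1).factorial) = (x+y) * (poch (x+y+1) n / n.factorial) := by
      have := A (x+y) n; push_cast at this ⊢; exact this
    apply mul_left_cancel₀ hn
    rw [key, this, show x + 1 + y = x+y+1 by ring, show x + (y+1) = x+y+1 by ring]
    ring

/-- The Saalschutz coefficient identity behind the Euler transformation -/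
lemma euler_coeff (a b c : ℝ) (hc : 0 < c) (k : ℕ) :
    ∑ p ∈ Finset.HasAntidiagonal.antidiagonal k, (poch (a+b-c) p.1 / p.1.factorial) *
      (poch (c-a) p.2 * poch (c-b) p.2 / (poch c p.2 * p.2.factorial))
      = poch a k * poch b k / (poch c k * k.factorial) := by
  have hp : ∀ j, poch c j ≠ 0 := fun j => (poch_pos hc j).ne'
  have h1 : ∀ p ∈ Finset.HasAntidiagonal.antidiagonal k, (poch (a+b-c) p.1 / p.1.factorial) *
      (poch (c-a) p.2 * poch (c-b) p.2 / (poch c p.2 * p.2.factorial))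
      = ∑ q ∈ Finset.HasAntidiagonal.antidiagonal p.2, (poch (a+b-c) p.1 / p.1.factorial) *
       ((-1:ℝ)^q.1 * poch b q.1 / (poch c q.1 * q.1.factorial) * poch (c-a) q.1 *
        (poch (c-a+q.1) q.2 / q.2.factorial)) := by
    intro p _
    have := vand1 p.2 b c hc
    have e : poch (c-a) p.2 * poch (c-b) p.2 / (poch c p.2 * p.2.factorial)
       = poch (c-a) p.2 / p.2.factorial * (poch (c-b) p.2 / poch c p.2) := by
      have := hp p.2
      field_simp
    rw [e, ← this, Finset.Nat.sum_antidiagonal_eq_sum_range_succ_mk, Finset.mul_sum, Finset.mul_sum]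
    apply Finset.sum_congr rfl
    intro j hj
    have hj' : j ≤ p.2 := Nat.lt_succ_iff.1 (Finset.mem_range.1 hj)
    obtain ⟨m, hm⟩ := Nat.exists_eq_add_of_le hj'
    rw [hm, Nat.add_sub_cancel_left, poch_add, Nat.cast_add_choose ℝ]
    have := hp j
    field_simp
  rw [Finset.sum_congr rfl h1, Finset.sum_sigma']
  have h2 : ∑ x ∈ (Finset.HasAntidiagonal.antidiagonal k).sigma fun p => Finset.HasAntidiagonal.antidiagonal p.2,
      (poch (a+b-c) x.1.1 / x.1.1.factorial) *
       ((-1:ℝ)^x.2.1 * poch b x.2.1 / (poch c x.2.1 * x.2.1.factorial) * poch (c-a) x.2.1 *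
        (poch (c-a+x.2.1) x.2.2 / x.2.2.factorial))
     = ∑ x ∈ (Finset.HasAntidiagonal.antidiagonal k).sigma fun p => Finset.HasAntidiagonal.antidiagonal p.2,
      ((-1:ℝ)^x.1.1 * poch b x.1.1 / (poch c x.1.1 * x.1.1.factorial) * poch (c-a) x.1.1) *
       ((poch (a+b-c) x.2.1 / x.2.1.factorial) * (poch (c-a+x.1.1) x.2.2 / x.2.2.factorial)) := by
    refine Finset.sum_nbij' (fun x => ⟨(x.2.1, x.1.1 + x.2.2), (x.1.1, x.2.2)⟩)
      (fun x => ⟨(x.2.1, x.1.1 + x.2.2), (x.1.1, x.2.2)⟩) ?_ ?_ ?_ ?_ ?_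
    · rintro ⟨⟨p, q⟩, ⟨r, s⟩⟩ h
      simp only [Finset.mem_sigma, Finset.HasAntidiagonal.mem_antidiagonal] at h ⊢
      refine ⟨?_, trivial⟩
      omega
    · rintro ⟨⟨p, q⟩, ⟨r, s⟩⟩ h
      simp only [Finset.mem_sigma, Finset.HasAntidiagonal.mem_antidiagonal] at h ⊢
      refine ⟨?_, trivial⟩
      omega
    · rintro ⟨⟨p, q⟩, ⟨r, s⟩⟩ h
      simp only [Finset.mem_sigma, Finset.HasAntidiagonal.mem_antidiagonal] at h ⊢
      obtain ⟨h1, rfl⟩ := h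
      rfl
    · rintro ⟨⟨p, q⟩, ⟨r, s⟩⟩ h
      simp only [Finset.mem_sigma, Finset.HasAntidiagonal.mem_antidiagonal] at h ⊢
      obtain ⟨h1, rfl⟩ := h
      rfl
    · rintro ⟨⟨p, q⟩, ⟨r, s⟩⟩ h
      simp only
      ring
  rw [h2, Finset.sum_sigma]
  simp only
  have h3 : ∀ p ∈ Finset.HasAntidiagonal.antidiagonal k, ∑ q ∈ Finset.HasAntidiagonal.antidiagonal p.2,
      ((-1:ℝ)^p.1 * poch b p.1 / (poch c p.1 * p.1.factorial) * poch (c-a) p.1) *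
       ((poch (a+b-c) q.1 / q.1.factorial) * (poch (c-a+p.1) q.2 / q.2.factorial))
      = poch b k / k.factorial * ((-1:ℝ)^p.1 * (k.choose p.1) * poch (c-a) p.1 / poch c p.1) := by
    intro p hp'
    rw [← Finset.mul_sum, vand2]
    have hk := Finset.HasAntidiagonal.mem_antidiagonal.1 hp'
    rw [← hk, poch_add, Nat.cast_add_choose ℝ, show a + b - c + (c - a + p.1) = b + p.1 by ring]
    have := hp p.1
    field_simp
  rw [Finset.sum_congr rfl h3, ← Finset.mul_sum, Finset.Nat.sum_antidiagonal_eq_sum_range_succ_mk]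
  simp only
  rw [vand1 k _ _ hc, show c - (c - a) = a by ring]
  have := hp k
  field_simp

/-- coefficient identity behind the quadratic transformation -/
lemma quad_coeff (s c : ℝ) (hc : 0 < c) (k : ℕ) :
    ∑ p ∈ Finset.HasAntidiagonal.antidiagonal k, poch s (2*p.1) / (poch c p.1 * p.1.factorial) *
      ((-1:ℝ)^p.2 * poch (s + 2*p.1) p.2 / p.2.factorial)
      = poch s k * poch (s+1-c) k / (poch c k * k.factorial) := by
  have hp : ∀ j, poch c j ≠ 0 := fun j => (poch_pos hc j).ne'
  have h3 : ∀ p ∈ Finset.HasAntidiagonal.antidiagonal k, poch s (2*p.1) / (poch c p.1 * p.1.factorial) *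
      ((-1:ℝ)^p.2 * poch (s + 2*p.1) p.2 / p.2.factorial)
      = (-1:ℝ)^k * poch s k / k.factorial * ((-1:ℝ)^p.1 * (k.choose p.1) * poch (s+k) p.1 / poch c p.1) := by
    intro p hp'
    have hk := Finset.HasAntidiagonal.mem_antidiagonal.1 hp'
    have e1 : poch s (2*p.1) * poch (s+2*p.1) p.2 = poch s k * poch (s+k) p.1 := by
      have := poch_add s (2*p.1) p.2
      push_cast at this
      rw [← this, ← poch_add, ← hk]
      congr 1; ring
    have e2 : (-1:ℝ)^p.2 = (-1:ℝ)^k * (-1:ℝ)^p.1 := by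
      rw [← hk, ← pow_add]
      rw [show p.1 + p.2 + p.1 = 2 * p.1 + p.2 by ring, pow_add, pow_mul]; simp
    have e3 : poch s (2*p.1) / (poch c p.1 * p.1.factorial) *
      ((-1:ℝ)^p.2 * poch (s + 2*p.1) p.2 / p.2.factorial) = (poch s (2*p.1) * poch (s+2*p.1) p.2) * (-1:ℝ)^p.2 / (poch c p.1 * p.1.factorial * p.2.factorial) := by
      have := hp p.1
      field_simp
    rw [e3, e1, e2]
    have : (k.choose p.1 : ℝ) = k.factorial / (p.1.factorial * p.2.factorial) := by
      rw [← hk, Nat.cast_add_choose ℝ]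
    rw [this]
    have := hp p.1
    field_simp
  rw [Finset.sum_congr rfl h3, ← Finset.mul_sum, Finset.Nat.sum_antidiagonal_eq_sum_range_succ_mk]
  simp only
  rw [vand1 k _ _ hc]
  have : (-1:ℝ)^k * poch (c - (s+k)) k = poch (s+1-c) k := by
    clear h3
    have : ∀ (k : ℕ) (x : ℝ), (-1:ℝ)^k * poch (-(x+k)) k = poch (x+1) k := by
      intro k
      induction k with
      | zero => simp [poch_zero]
      | succ k ih =>
        intro x
        rw [poch_succ_left, poch_succ, ← ih x]
        push_cast
        rw [show -(x + (k+1)) + 1 = -(x + k) by ring]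
        ring
    rw [show s + 1 - c = (s - c) + 1 by ring, ← this, show c - (s + k) = -(s-c+k) by ring]
  rw [← this]
  have := hp k
  field_simp

lemma poch_two_mul (s : ℝ) (j : ℕ) : poch s (2*j) = 4^j * poch (s/2) j * poch ((s+1)/2) j := by
  induction j with
  | zero => simp [poch_zero]
  | succ j ih =>
    rw [show 2*(j+1) = 2*j+1+1 by ring, poch_succ, poch_succ, ih, poch_succ, poch_succ]
    push_cast; ring


/-- hypergeometric coefficient -/
noncomputable def hco (a b c : ℝ) (k : ℕ) : ℝ := poch a k * poch b k / (poch c k * k.factorial)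

lemma hyp2F1_eq (a b c z : ℝ) : hyp2F1 a b c z = ∑' k, hco a b c k * z ^ k := rfl

lemma hco_succ (a b c : ℝ) (hc : 0 < c) (k : ℕ) :
    hco a b c (k+1) = hco a b c k * ((a + k) / (c + k) * ((b + k) / (1 + k))) := by
  unfold hco
  have h1 := (poch_pos hc k).ne'
  have h2 : (c + k) ≠ 0 := by positivity
  have h3 : (1 + (k:ℝ)) ≠ 0 := by positivity
  rw [poch_succ, poch_succ, poch_succ, Nat.factorial_succ]
  push_cast
  have h4 : ((k:ℝ) + 1) ≠ 0 := by positivity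
  field_simp
  ring

lemma hco_summable (a b c : ℝ) (hc : 0 < c) {z : ℝ} (hz : |z| < 1) :
    Summable fun k => |hco a b c k * z ^ k| := by
  obtain ⟨r, hr1, hr2⟩ := exists_between hz
  have lim : Filter.Tendsto (fun k : ℕ => |(a + k) / (c + k) * ((b + k) / (1 + k))| * |z|)
      Filter.atTop (nhds (|1 * 1| * |z|)) := by
    refine ((Filter.Tendsto.mul ?_ ?_).abs).mul_const _
    · simpa using tendsto_add_mul_div_add_mul_atTop_nhds a c (1:ℝ) (one_ne_zero)
    · simpa using tendsto_add_mul_div_add_mul_atTop_nhds b 1 (1:ℝ) (one_ne_zero)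
  simp only [mul_one, abs_one, one_mul] at lim
  refine summable_of_ratio_norm_eventually_le hr2 ?_
  filter_upwards [lim.eventually (gt_mem_nhds hr1)] with k hk
  rw [hco_succ a b c hc, pow_succ]
  simp only [norm_eq_abs, abs_abs]
  rw [show hco a b c k * ((a + k) / (c + k) * ((b + k) / (1 + k))) * (z ^ k * z)
    = ((a + k) / (c + k) * ((b + k) / (1 + k))) * z * (hco a b c k * z ^ k) by ring, abs_mul, abs_mul _ z]
  exact mul_le_mul_of_nonneg_right hk.le (abs_nonneg _)

lemma hco_hasSum (a b c : ℝ) (hc : 0 < c) {z : ℝ} (hz : |z| < 1) :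
    HasSum (fun k => hco a b c k * z ^ k) (hyp2F1 a b c z) :=
  (hco_summable a b c hc hz).of_abs.hasSum

lemma hco_one (a : ℝ) (k : ℕ) : hco a 1 1 k = poch a k / k.factorial := by
  unfold hco
  rw [poch_one]
  field_simp

lemma binom_hasSum (a : ℝ) {w : ℝ} (hw : |w| < 1) :
    HasSum (fun k => poch a k / k.factorial * w ^ k) ((1 - w) ^ (-a)) := by
  have h := (Real.one_add_rpow_hasFPowerSeriesOnBall_zero (a := -a)).hasSum (y := -w)
    (by simpa [enorm_eq_nnnorm, ← NNReal.coe_lt_coe] using hw)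
  rw [binomialSeries_eq_ordinaryHypergeometricSeries (b := 1)
    (by intro k hk; have : (0:ℝ) ≤ k := by positivity
        linarith)] at h
  simp only [neg_neg, zero_add] at h
  rw [← sub_eq_add_neg] at h
  have e : (fun k => poch a k / k.factorial * w ^ k) = fun n =>
    ((ordinaryHypergeometricSeries ℝ a 1 1).compContinuousLinearMap
      (-ContinuousLinearMap.id ℝ ℝ) n) fun _ => -w := by
    funext k
    rw [FormalMultilinearSeries.compContinuousLinearMap_apply]
    have := ordinaryHypergeometricSeries_apply_eq a (1:ℝ) (1:ℝ) w k
    have e2 : ((-ContinuousLinearMap.id ℝ ℝ : ℝ →L[ℝ] ℝ) ∘ fun _ : Fin k => -w) = fun _ => w := by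
      ext i; simp
    rw [e2, this]
    have := poch_one k
    unfold poch at this ⊢
    rw [this, smul_eq_mul]
    field_simp
  rw [e]; exact h

lemma euler_transform (a b c : ℝ) (hc : 0 < c) {w : ℝ} (hw : |w| < 1) :
    (1 - w) ^ (c - a - b) * hyp2F1 (c-a) (c-b) c w = hyp2F1 a b c w := by
  have h1 := binom_hasSum (a+b-c) hw
  rw [show -(a+b-c) = c - a - b by ring] at h1
  rw [← h1.tsum_eq, hyp2F1_eq, hyp2F1_eq]
  rw [tsum_mul_tsum_eq_tsum_sum_antidiagonal_of_summable_norm]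
  · congr 1; ext n
    rw [hco, ← euler_coeff a b c hc n, Finset.sum_mul]
    apply Finset.sum_congr rfl
    intro p hp
    have hk := Finset.HasAntidiagonal.mem_antidiagonal.1 hp
    rw [← hk, pow_add, hco]; ring
  · have := hco_summable (a+b-c) 1 1 one_pos hw
    simpa only [hco_one, norm_eq_abs] using this
  · exact hco_summable _ _ _ hc hw


lemma hyp_analytic (a b c : ℝ) (hc : 0 < c) :
    AnalyticOnNhd ℝ (hyp2F1 a b c) (Metric.ball 0 1) := by
  have hr : 1 ≤ (FormalMultilinearSeries.ofScalars ℝ (hco a b c)).radius := by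
    apply ENNReal.le_of_forall_nnreal_lt
    intro r hr
    apply FormalMultilinearSeries.le_radius_of_summable_norm
    have h := hco_summable a b c hc (z := (r:ℝ)) (by
      rw [abs_of_nonneg (NNReal.coe_nonneg r)]; exact_mod_cast hr)
    refine h.congr fun n => ?_
    rw [FormalMultilinearSeries.ofScalars_norm, abs_mul, norm_eq_abs, abs_of_nonneg (pow_nonneg (NNReal.coe_nonneg r) n)]
  have h := (FormalMultilinearSeries.ofScalars ℝ (hco a b c)).hasFPowerSeriesOnBall
    (lt_of_lt_of_le one_pos hr)
  have h2 := h.mono one_pos hr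
  have e : (FormalMultilinearSeries.ofScalars ℝ (hco a b c)).sum = hyp2F1 a b c := by
    funext z
    rw [hyp2F1_eq, FormalMultilinearSeries.sum]
    congr 1; ext n; simp [mul_comm]
  rw [e] at h2
  have := h2.analyticOnNhd
  rwa [← ENNReal.ofReal_one, Metric.eball_ofReal] at this

lemma abs_poch_le (s : ℝ) (n : ℕ) : |poch s n| ≤ poch |s| n := by
  induction n with
  | zero => simp [poch_zero]
  | succ n ih =>
    rw [poch_succ, poch_succ, abs_mul]
    refine mul_le_mul ih ?_ (abs_nonneg _) ((abs_nonneg _).trans ih)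
    exact (abs_add_le _ _).trans (by simp)

lemma poch_mono {s t : ℝ} (hs : 0 ≤ s) (h : s ≤ t) (n : ℕ) : 0 ≤ poch s n ∧ poch s n ≤ poch t n := by
  induction n with
  | zero => simp [poch_zero]
  | succ n ih =>
    rw [poch_succ, poch_succ]
    refine ⟨mul_nonneg ih.1 (by positivity), ?_⟩
    exact mul_le_mul ih.2 (by linarith) (by positivity) (ih.1.trans ih.2)

lemma hco_quad (s c : ℝ) (j : ℕ) :
    hco (s/2) ((s+1)/2) c j * 4 ^ j = poch s (2*j) / (poch c j * j.factorial) := by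
  rw [poch_two_mul, hco]; ring

lemma quad_local (s c : ℝ) (hc : 0 < c) {w : ℝ} (hw : |w| < 1/10) :
    (1 + w) ^ (-s) * hyp2F1 (s/2) ((s+1)/2) c (4 * w / (1+w)^2) = hyp2F1 s (s+1-c) c w := by
  have hw' := abs_lt.1 hw
  have hw1 : |w| < 1 := by linarith
  have h1w : 0 < 1 + w := by linarith
  have h1w' : 0 < 1 - |w| := by linarith
  set f : ℕ × ℕ → ℝ := fun p => (poch s (2*p.1) / (poch c p.1 * p.1.factorial) *
      ((-1:ℝ)^p.2 * poch (s + 2*p.1) p.2 / p.2.factorial)) * w ^ (p.1 + p.2) with hf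
  set g : ℕ × ℕ → ℝ := fun p => (poch |s| (2*p.1) / (poch c p.1 * p.1.factorial) * |w| ^ p.1) *
      (poch (|s| + 2*p.1) p.2 / p.2.factorial * |w| ^ p.2) with hg
  have hsn := abs_nonneg s
  have g0 : 0 ≤ g := by
    intro p
    have h1 := (poch_mono hsn le_rfl (2*p.1)).1
    have h2 := (poch_mono (s := |s| + 2*p.1) (by positivity) le_rfl p.2).1
    have h3 := poch_pos hc p.1
    simp only [hg, Pi.zero_apply]
    positivity
  have gin : ∀ j, HasSum (fun m => g (j, m)) ((poch |s| (2*j) / (poch c j * j.factorial) * |w| ^ j) *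
      (1 - |w|) ^ (-(|s| + 2*j))) := by
    intro j
    exact (binom_hasSum (|s| + 2*j) (w := |w|) (by simpa using hw1)).mul_left _
  have gs : Summable g := by
    rw [summable_prod_of_nonneg g0]
    refine ⟨fun j => (gin j).summable, ?_⟩
    simp_rw [fun j => (gin j).tsum_eq]
    have hz : |4 * |w| / (1 - |w|)^2| < 1 := by
      rw [abs_of_nonneg (by positivity), div_lt_one (by positivity)]
      nlinarith [abs_nonneg w]
    have := ((hco_summable (|s|/2) ((|s|+1)/2) c hc hz).of_abs).mul_left ((1 - |w|) ^ (-|s|))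
    refine this.congr fun j => ?_
    rw [← hco_quad, neg_add, rpow_add h1w', show (-(2*(j:ℝ))) = -((2*j : ℕ):ℝ) by push_cast; ring,
      rpow_neg h1w'.le (((2*j:ℕ):ℝ)), rpow_natCast, pow_mul, div_pow, mul_pow]
    ring
  have fg : ∀ p, ‖f p‖ ≤ g p := by
    intro p
    have h3 := poch_pos hc p.1
    simp only [hf, hg, norm_eq_abs, abs_mul, abs_div, abs_pow, abs_neg, abs_one, one_pow, one_mul,
      Nat.abs_cast, abs_of_pos h3, pow_add]
    have e1 := abs_poch_le s (2*p.1)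
    have e2 : |poch (s + 2*p.1) p.2| ≤ poch (|s| + 2*p.1) p.2 := by
      refine (abs_poch_le _ _).trans (poch_mono (abs_nonneg _) ?_ _).2
      exact (abs_add_le _ _).trans (by simp)
    rw [show |poch s (2 * p.1)| / (poch c p.1 * p.1.factorial) * (|poch (s + 2 * p.1) p.2| / p.2.factorial) *
      (|w| ^ p.1 * |w| ^ p.2) = (|poch s (2 * p.1)| / (poch c p.1 * p.1.factorial) * |w| ^ p.1) *
       ((|poch (s + 2 * p.1) p.2| / p.2.factorial) * |w| ^ p.2) by ring]
    have := (poch_mono hsn le_rfl (2*p.1)).1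
    gcongr
  have fs : Summable f := Summable.of_norm_bounded gs fg
  have fin : ∀ j, HasSum (fun m => f (j, m)) ((poch s (2*j) / (poch c j * j.factorial) * w ^ j) *
      (1 + w) ^ (-(s + 2*j))) := by
    intro j
    have := (binom_hasSum (s + 2*j) (w := -w) (by simpa using hw1)).mul_left (poch s (2*j) / (poch c j * j.factorial) * w ^ j)
    rw [sub_neg_eq_add] at this
    refine this.congr_fun ?_
    intro m
    simp only [hf]
    rw [pow_add, neg_pow w]; ring
  have T1 : ∑' p, f p = (1 + w) ^ (-s) * hyp2F1 (s/2) ((s+1)/2) c (4 * w / (1+w)^2) := by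
    rw [fs.tsum_prod' (fun j => (fin j).summable), hyp2F1_eq, ← tsum_mul_left]
    congr 1; ext j
    rw [(fin j).tsum_eq]
    rw [← hco_quad, neg_add, rpow_add h1w, show (-(2*(j:ℝ))) = -((2*j : ℕ):ℝ) by push_cast; ring,
      rpow_neg h1w.le (((2*j:ℕ):ℝ)), rpow_natCast, pow_mul, div_pow, mul_pow]
    ring
  rw [← T1, ← Finset.HasAntidiagonal.sigmaAntidiagonalEquivProd.tsum_eq]
  have fs' := Finset.HasAntidiagonal.sigmaAntidiagonalEquivProd.summable_iff.2 fs
  change ∑' p, (f ∘ Finset.HasAntidiagonal.sigmaAntidiagonalEquivProd) p = _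
  rw [Summable.tsum_sigma' (fun n => (hasSum_fintype _).summable) fs', hyp2F1_eq]
  congr 1; ext n
  rw [tsum_fintype]
  simp only [Finset.univ_eq_attach, Function.comp_apply, Finset.HasAntidiagonal.sigmaAntidiagonalEquivProd_apply]
  rw [Finset.sum_attach (Finset.HasAntidiagonal.antidiagonal n) f, hco, ← quad_coeff s c hc n, Finset.sum_mul]
  apply Finset.sum_congr rfl
  intro p hp
  have hk := Finset.HasAntidiagonal.mem_antidiagonal.1 hp
  rw [← hk]

lemma quad_transform (s c : ℝ) (hc : 0 < c) {w : ℝ} (hw0 : 0 ≤ w) (hw : w < 1) :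
    (1 + w) ^ (-s) * hyp2F1 (s/2) ((s+1)/2) c (4 * w / (1+w)^2) = hyp2F1 s (s+1-c) c w := by
  have hin : ∀ x ∈ Set.Ioo (-1/10:ℝ) 1, 0 < 1 + x ∧ |4 * x / (1+x)^2| < 1 := by
    intro x hx
    have h1 : 0 < 1 + x := by linarith [hx.1]
    refine ⟨h1, ?_⟩
    rw [abs_lt, lt_div_iff₀ (by positivity), div_lt_one (by positivity)]
    constructor
    · nlinarith [hx.1, hx.2]
    · have : 0 < (1-x)^2 := by have := hx.2; apply pow_pos; linarith
      nlinarith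
  have A : AnalyticOnNhd ℝ (fun w : ℝ => (1 + w) ^ (-s) * hyp2F1 (s/2) ((s+1)/2) c (4 * w / (1+w)^2))
      (Set.Ioo (-1/10:ℝ) 1) := by
    intro x hx
    obtain ⟨h1, h2⟩ := hin x hx
    have e1 : AnalyticAt ℝ (fun w : ℝ => 4 * w / (1+w)^2) x := by
      apply AnalyticAt.div (by fun_prop) (by fun_prop)
      positivity
    have e2 : AnalyticAt ℝ (fun w : ℝ => (1 + w) ^ (-s)) x := by
      have := (Real.one_add_rpow_hasFPowerSeriesOnBall_zero (a := -s)).analyticOnNhd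
      rw [← ENNReal.ofReal_one, Metric.eball_ofReal] at this
      apply this x
      have := hx.1; have := hx.2
      rw [mem_ball_zero_iff, norm_eq_abs, abs_lt]; constructor <;> linarith
    apply e2.mul
    have := hyp_analytic (s/2) ((s+1)/2) c hc (4 * x / (1+x)^2) (by rwa [mem_ball_zero_iff, norm_eq_abs])
    exact this.comp_of_eq e1 rfl
  have B : AnalyticOnNhd ℝ (hyp2F1 s (s+1-c) c) (Set.Ioo (-1/10:ℝ) 1) := by
    refine (hyp_analytic _ _ c hc).mono ?_
    intro x hx
    have := hx.1; have := hx.2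
    simp [abs_lt]; constructor <;> linarith
  have := A.eqOn_of_preconnected_of_eventuallyEq B isPreconnected_Ioo (z₀ := 0) (by constructor <;> norm_num) ?_
  · exact this ⟨by linarith, hw⟩
  · have : Metric.ball (0:ℝ) (1/10) ∈ nhds (0:ℝ) := Metric.ball_mem_nhds _ (by norm_num)
    filter_upwards [this] with x hx
    exact quad_local s c hc (by simpa using hx)


section polar
variable {d : ℕ}

/-- Euclidean space abbreviation -/
abbrev EE (d : ℕ) := EuclideanSpace ℝ (Fin d)

/-- the sphere measure -/
noncomputable abbrev sg (d : ℕ) : Measure (Metric.sphere (0 : EE d) 1) :=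
  (volume : Measure (EE d)).toSphere

/-- the radial measure -/
noncomputable abbrev nu (d : ℕ) : Measure (Set.Ioi (0:ℝ)) := Measure.volumeIoiPow (d - 1)

lemma polar_mp (d : ℕ) : MeasurePreserving (homeomorphUnitSphereProd (EE d))
    ((volume : Measure (EE d)).comap (↑)) ((sg d).prod (nu d)) := by
  have := (volume : Measure (EE d)).measurePreserving_homeomorphUnitSphereProd
  simpa using this

lemma polar_integral (hd : 1 ≤ d) (f : EE d → ℝ) :
    ∫ x, f x = ∫ p, f ((p.2 : ℝ) • (p.1 : EE d)) ∂((sg d).prod (nu d)) := by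
  have : Nonempty (Fin d) := ⟨⟨0, hd⟩⟩
  have : Nontrivial (EE d) := inferInstance
  rw [← (polar_mp d).integral_comp (Homeomorph.measurableEmbedding _)]
  have := integral_subtype_comap (μ := (volume : Measure (EE d)))
    (measurableSet_singleton (0 : EE d)).compl f
  rw [restrict_compl_singleton] at this
  rw [← this]
  apply integral_congr_ae
  refine .of_forall fun x => ?_
  have h : (x : EE d) ≠ 0 := x.2
  simp [smul_smul, h]

lemma polar_integrable (hd : 1 ≤ d) (f : EE d → ℝ) :
    Integrable f ↔ Integrable (fun p : Metric.sphere (0 : EE d) 1 × Set.Ioi (0:ℝ) => f ((p.2 : ℝ) • (p.1 : EE d))) ((sg d).prod (nu d)) := by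
  have : Nonempty (Fin d) := ⟨⟨0, hd⟩⟩
  have : Nontrivial (EE d) := inferInstance
  rw [← (polar_mp d).integrable_comp_emb (Homeomorph.measurableEmbedding _)]
  have h0 : Integrable f ↔ IntegrableOn f {0}ᶜ := by
    rw [IntegrableOn, restrict_compl_singleton]
  rw [h0, integrableOn_iff_comap_subtypeVal (by measurability)]
  apply integrable_congr
  refine .of_forall fun x => ?_
  have h : (x : EE d) ≠ 0 := x.2
  simp [smul_smul, h]

lemma nu_integral (f : ℝ → ℝ) :
    ∫ r : Set.Ioi (0:ℝ), f r ∂(nu d) = ∫ r in Set.Ioi (0:ℝ), r ^ (d-1) * f r := by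
  simp only [nu, Measure.volumeIoiPow, ENNReal.ofReal]
  rw [integral_withDensity_eq_integral_smul,
    integral_subtype_comap measurableSet_Ioi fun a ↦ Real.toNNReal (a ^ (d - 1)) • f a,
    setIntegral_congr_fun measurableSet_Ioi fun x hx ↦ ?_]
  · simp only [NNReal.smul_def, smul_eq_mul]
    rw [Real.coe_toNNReal _ (pow_nonneg hx.out.le _)]
  · exact (measurable_subtype_coe.pow_const _).real_toNNReal

lemma nu_integrable (f : ℝ → ℝ) :
    Integrable (fun r : Set.Ioi (0:ℝ) => f r) (nu d) ↔
      IntegrableOn (fun r => r ^ (d-1) * f r) (Set.Ioi (0:ℝ)) := by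
  rw [integrableOn_iff_comap_subtypeVal (by measurability), nu, Measure.volumeIoiPow,
    integrable_withDensity_iff_integrable_smul', integrable_congr]
  · refine .of_forall ?_
    rintro ⟨x, hx : 0 < x⟩
    simp (disch := positivity) [ENNReal.toReal_ofReal]
  · fun_prop
  · simp

/-- transfer between Gaussian integrals and sphere integrals -/
lemma sphere_gauss (hd : 1 ≤ d) (n : ℕ) (g : EE d → ℝ)
    (hg : ∀ (r : ℝ) (z : EE d), 0 < r → g (r • z) = r ^ n * g z) :
    ∫ z, g z * exp (-‖z‖^2) = (∫ θ, g θ ∂(sg d)) * (Real.Gamma (((n:ℝ)+d)/2) / 2) := by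
  rw [polar_integral hd]
  have e : ∀ p : Metric.sphere (0 : EE d) 1 × Set.Ioi (0:ℝ),
      g ((p.2:ℝ) • (p.1 : EE d)) * exp (-‖(p.2:ℝ) • (p.1 : EE d)‖^2)
      = g p.1 * ((p.2:ℝ)^n * exp (-(p.2:ℝ)^2)) := by
    rintro ⟨θ, r, hr⟩
    have hr' : 0 < r := hr
    rw [hg _ _ hr', norm_smul]
    simp
    ring
  simp_rw [e]
  rw [integral_prod_mul (fun θ : Metric.sphere (0 : EE d) 1 => g θ) (fun r : Set.Ioi (0:ℝ) => (r:ℝ)^n * exp (-(r:ℝ)^2))]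
  congr 1
  rw [nu_integral (fun r => r^n * exp (-r^2))]
  have := _root_.integral_rpow_mul_exp_neg_rpow (p := 2) (q := (n:ℝ)+d-1) (by norm_num) (by
    have : (1:ℝ) ≤ d := by exact_mod_cast hd
    have : (0:ℝ) ≤ n := by positivity
    linarith)
  rw [show (n:ℝ) + d - 1 + 1 = n + d by ring] at this
  rw [div_eq_mul_one_div, mul_comm, ← this]
  apply setIntegral_congr_fun measurableSet_Ioi
  intro r hr
  have hr' : 0 < r := hr
  simp only [rpow_two]
  rw [← mul_assoc, ← pow_add, ← rpow_natCast]
  rw [Nat.cast_add, Nat.cast_sub hd]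
  push_cast
  rw [show (d:ℝ) - 1 + n = n + d - 1 by ring]

lemma gauss_coord (hd : 1 ≤ d) (j : ℕ) :
    ∫ z : EE d, (z ⟨0, hd⟩)^(2*j) * exp (-‖z‖^2) = Real.Gamma (j + 1/2) * π ^ (((d:ℝ)-1)/2) := by
  rw [← (PiLp.volume_preserving_toLp (Fin d)).integral_comp (MeasurableEquiv.toLp 2 (Fin d → ℝ)).measurableEmbedding]
  have e : ∀ x : Fin d → ℝ, ((WithLp.toLp 2 x : EE d) ⟨0, hd⟩)^(2*j) * exp (-‖(WithLp.toLp 2 x : EE d)‖^2)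
     = ∏ i, (if i = ⟨0, hd⟩ then (x i)^(2*j) else 1) * exp (-(x i)^2) := by
    intro x
    rw [Finset.prod_mul_distrib, Finset.prod_ite_eq', ← Real.exp_sum, EuclideanSpace.norm_sq_eq]
    simp
  simp_rw [e]
  rw [integral_fintype_prod_volume_eq_prod (fun (i : Fin d) (x:ℝ) => (if i = ⟨0, hd⟩ then x^(2*j) else 1) * exp (-x^2))]
  rw [← Finset.mul_prod_erase Finset.univ _ (Finset.mem_univ ⟨0, hd⟩)]
  congr 1
  · simp only [if_true]
    have : ∫ x : ℝ, x^(2*j) * exp (-x^2) = ∫ x : ℝ, (fun t => t^(2*j) * exp (-t^2)) |x| := by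
      congr 1; ext x; simp [pow_mul]
    rw [this, integral_comp_abs (f := fun t : ℝ => t^(2*j) * exp (-t^2))]
    have := _root_.integral_rpow_mul_exp_neg_rpow (p := 2) (q := ((2*j:ℕ):ℝ)) (by norm_num) (by
      have : (0:ℝ) ≤ ((2*j:ℕ):ℝ) := by positivity
      linarith)
    simp only [rpow_natCast, rpow_two] at this
    rw [this]
    push_cast
    rw [show (2 * (j:ℝ) + 1)/2 = j + 1/2 by ring]
    ring
  · rw [Finset.prod_congr rfl (g := fun _ => π ^ ((1:ℝ)/2))]
    · rw [Finset.prod_const, Finset.card_erase_of_mem (Finset.mem_univ _), Finset.card_univ, Fintype.card_fin,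
        ← rpow_natCast, ← rpow_mul pi_pos.le, Nat.cast_sub hd]
      congr 1; push_cast; ring
    · intro i hi
      have := Finset.ne_of_mem_erase hi
      have h := integral_gaussian 1
      simp only [this, if_false, one_mul]
      simp only [neg_mul, one_mul, div_one] at h
      rw [h, sqrt_eq_rpow]

lemma gauss_inner (hd : 1 ≤ d) (j : ℕ) (x : EE d) :
    ∫ z : EE d, (inner ℝ x z)^(2*j) * exp (-‖z‖^2) = ‖x‖^(2*j) * (Real.Gamma (j + 1/2) * π ^ (((d:ℝ)-1)/2)) := by
  set e : EE d := EuclideanSpace.single ⟨0, hd⟩ ‖x‖ with he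
  have hn : ‖x‖ = ‖e‖ := by simp [he]
  set T := (Submodule.span ℝ {x - e})ᗮ.reflection with hT
  have hTx : T x = e := Submodule.reflection_sub hn
  have h1 : ∀ z, inner ℝ x (T.symm z) = ‖x‖ * z ⟨0, hd⟩ := by
    intro z
    rw [← LinearIsometryEquiv.inner_map_map T, hTx, LinearIsometryEquiv.apply_symm_apply, he,
      EuclideanSpace.inner_single_left]
    simp
  rw [← (T.symm.measurePreserving).integral_comp T.symm.toHomeomorph.measurableEmbedding]
  simp_rw [h1, LinearIsometryEquiv.norm_map, mul_pow, mul_assoc]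
  rw [integral_const_mul, gauss_coord]

lemma sphere_moment (hd : 1 ≤ d) (j : ℕ) (x : EE d) :
    ∫ θ : Metric.sphere (0 : EE d) 1, (inner ℝ x (θ : EE d))^(2*j) ∂(sg d) =
      2 * π ^ ((d:ℝ)/2) / Real.Gamma ((d:ℝ)/2) * (‖x‖^(2*j) * (poch (1/2) j / poch ((d:ℝ)/2) j)) := by
  have h := sphere_gauss hd (2*j) (fun z => (inner ℝ x z)^(2*j)) (by
    intro r z _; simp only [inner_smul_right, mul_pow])
  have hd' : (0:ℝ) < (d:ℝ)/2 := by have : (0:ℝ) < d := by exact_mod_cast hd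
                                   linarith
  rw [gauss_inner hd] at h
  have e1 : Real.Gamma (((2*j:ℕ):ℝ)/2 + d/2) = poch ((d:ℝ)/2) j * Real.Gamma ((d:ℝ)/2) := by
    rw [← Gamma_add_nat hd']; congr 1; push_cast; ring
  have e2 : Real.Gamma ((j:ℝ) + 1/2) = poch (1/2) j * π ^ ((1:ℝ)/2) := by
    rw [add_comm, Gamma_add_nat (by norm_num), Real.Gamma_one_half_eq, sqrt_eq_rpow]
  rw [add_div, e1, e2] at h
  have e3 : π ^ ((d:ℝ)/2) = π ^ ((1:ℝ)/2) * π ^ (((d:ℝ)-1)/2) := by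
    rw [← rpow_add pi_pos]; congr 1; ring
  have g1 := (Real.Gamma_pos_of_pos hd').ne'
  have g2 := (poch_pos hd' j).ne'
  rw [e3]
  field_simp
  field_simp at h
  linarith

lemma sphere_moment_odd (hd : 1 ≤ d) (j : ℕ) (x : EE d) :
    ∫ θ : Metric.sphere (0 : EE d) 1, (inner ℝ x (θ : EE d))^(2*j+1) ∂(sg d) = 0 := by
  have h := sphere_gauss hd (2*j+1) (fun z => (inner ℝ x z)^(2*j+1)) (by
    intro r z _; simp only [inner_smul_right, mul_pow])
  have hd' : (0:ℝ) < d := by exact_mod_cast hd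
  have g1 := (Real.Gamma_pos_of_pos (s := (((2*j+1:ℕ):ℝ)+d)/2) (by positivity)).ne'
  have h0 : ∫ z : EE d, (inner ℝ x z)^(2*j+1) * exp (-‖z‖^2) = 0 := by
    have := integral_neg_eq_self (fun z : EE d => (inner ℝ x z)^(2*j+1) * exp (-‖z‖^2)) volume
    simp only [inner_neg_right, norm_neg] at this
    have e : ∀ z : EE d, (-inner ℝ x z)^(2*j+1) * exp (-‖z‖^2) = - ((inner ℝ x z)^(2*j+1) * exp (-‖z‖^2)) := by
      intro z; rw [Odd.neg_pow ⟨j, rfl⟩]; ring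
    simp_rw [e] at this
    rw [integral_neg] at this
    linarith
  rw [h0] at h
  rcases mul_eq_zero.1 h.symm with h | h
  · exact h
  · exfalso; apply g1; linarith

end polar


lemma fact_two_mul (j : ℕ) : ((2*j).factorial : ℝ) = 4^j * poch (1/2) j * (j.factorial : ℝ) := by
  have := poch_two_mul 1 j
  rw [poch_one] at this
  rw [this, show ((1:ℝ)+1)/2 = 1 by norm_num, poch_one]

lemma integrable_cont_sphere {d : ℕ} (f : EE d → ℝ) (hf : Continuous f) :
    Integrable (fun θ : Metric.sphere (0 : EE d) 1 => f θ) (sg d) := by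
  have hc : Continuous (fun θ : Metric.sphere (0 : EE d) 1 => f θ) := hf.comp continuous_subtype_val
  have : CompactSpace (Metric.sphere (0 : EE d) 1) := isCompact_iff_compactSpace.1 (isCompact_sphere _ _)
  exact hc.integrable_of_hasCompactSupport (HasCompactSupport.of_compactSpace _)

lemma ang_aux {t : ℝ} (h1 : t < 1) : 2*t/(1+t^2) < 1 := by
  rw [div_lt_one (by positivity)]
  nlinarith [sq_nonneg (1-t), sub_pos.2 h1, mul_pos (sub_pos.2 h1) (sub_pos.2 h1)]

lemma angular {d : ℕ} (hd : 1 ≤ d) (s r : ℝ) (x : EE d) (hr : 0 ≤ r) (hx : ‖x‖ * r < 1) :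
    ∫ θ : Metric.sphere (0 : EE d) 1, (1 + ‖x‖^2*r^2 - 2*r*inner ℝ x (θ : EE d))^(-s) ∂(sg d) =
      2 * π ^ ((d:ℝ)/2) / Real.Gamma ((d:ℝ)/2) * hyp2F1 s (s+1-(d:ℝ)/2) ((d:ℝ)/2) (‖x‖^2*r^2) := by
  have hd' : (0:ℝ) < (d:ℝ)/2 := by have : (0:ℝ) < d := by exact_mod_cast hd
                                   linarith
  set w := ‖x‖^2*r^2 with hw
  have hw0 : 0 ≤ w := by positivity
  have hw1 : w < 1 := by
    rw [hw, ← mul_pow]; exact pow_lt_one₀ (by positivity) hx (by norm_num)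
  have hw2 : 0 < 1 + w := by linarith
  set q := 2*(‖x‖*r)/(1+w) with hq
  have hq0 : 0 ≤ q := by positivity
  have hq1 : q < 1 := by
    rw [hq, hw, ← mul_pow]; exact ang_aux hx
  set u : EE d → ℝ := fun z => 2*r/(1+w) * inner ℝ x z with hu
  have huc : Continuous u := by fun_prop
  have hub : ∀ θ : Metric.sphere (0 : EE d) 1, |u θ| ≤ q := by
    intro θ
    have : |inner ℝ x (θ : EE d)| ≤ ‖x‖ := by
      have := abs_real_inner_le_norm x (θ : EE d)
      simpa using this
    rw [hu]; simp only
    rw [abs_mul, abs_of_nonneg (by positivity), hq]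
    calc 2*r/(1+w) * |inner ℝ x (θ : EE d)| ≤ 2*r/(1+w) * ‖x‖ := by gcongr
      _ = _ := by ring
  have hs1 := hco_summable s 1 1 (z := q) one_pos (by rwa [abs_of_nonneg hq0])
  simp_rw [hco_one] at hs1
  have key := hasSum_integral_of_summable_integral_norm (μ := sg d)
    (F := fun (n : ℕ) (θ : Metric.sphere (0 : EE d) 1) => poch s n / n.factorial * (u θ)^n)
    (fun n => integrable_cont_sphere (fun z => poch s n / n.factorial * (u z)^n) (by fun_prop))
    (by
      refine Summable.of_nonneg_of_le (fun n => by positivity) (fun n => ?_)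
        (hs1.mul_right ((sg d).real Set.univ))
      calc _ ≤ ∫ θ : Metric.sphere (0 : EE d) 1, |poch s n / n.factorial * q^n| ∂(sg d) := by
            apply integral_mono
            · exact (integrable_cont_sphere (fun z => poch s n / n.factorial * (u z)^n) (by fun_prop)).norm
            · exact integrable_const _
            · intro θ
              simp only [norm_mul, abs_mul, norm_eq_abs, norm_pow, abs_pow]
              exact mul_le_mul_of_nonneg_left (pow_le_pow_left₀ (abs_nonneg _) ((hub θ).trans (le_abs_self q)) n) (abs_nonneg _)
        _ = _ := by rw [integral_const, smul_eq_mul, mul_comm])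
  have e1 : ∀ θ : Metric.sphere (0 : EE d) 1,
      ∑' n : ℕ, poch s n / n.factorial * (u θ)^n = (1 - u θ)^(-s) := fun θ =>
    (binom_hasSum s ((hub θ).trans_lt hq1)).tsum_eq
  simp_rw [e1] at key
  rw [← Function.Injective.hasSum_iff (mul_right_injective₀ (two_ne_zero' ℕ))] at key
  swap
  · intro n hn
    obtain ⟨j, rfl⟩ : ∃ j, n = 2*j+1 := by
      rcases Nat.even_or_odd' n with ⟨j, h | h⟩
      · exact absurd ⟨j, h.symm⟩ hn
      · exact ⟨j, h⟩
    rw [integral_const_mul]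
    simp only [hu, mul_pow]
    rw [integral_const_mul, sphere_moment_odd hd]
    simp
  have e2 : ∀ j : ℕ, ((fun n : ℕ => ∫ θ : Metric.sphere (0 : EE d) 1, poch s n / n.factorial * (u θ)^n ∂(sg d)) ∘ (fun j => 2*j)) j
      = 2 * π ^ ((d:ℝ)/2) / Real.Gamma ((d:ℝ)/2) * (hco (s/2) ((s+1)/2) ((d:ℝ)/2) j * (4*w/(1+w)^2)^j) := by
    intro j
    have h4 := hco_quad s ((d:ℝ)/2) j
    simp only [Function.comp]
    rw [integral_const_mul]
    simp only [hu, mul_pow]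
    rw [integral_const_mul, sphere_moment hd, fact_two_mul]
    rw [show 4*w/(1+w)^2 = 4 * (w/(1+w)^2) by ring, mul_pow 4, ← mul_assoc (hco _ _ _ _), h4, hw]
    have g1 := (poch_pos (a := 1/2) (by norm_num) j).ne'
    have g2 := (poch_pos hd' j).ne'
    rw [← hw, div_pow, div_pow, pow_mul (2*r), mul_pow 2 r, show (2:ℝ)^2 = 4 by norm_num, mul_pow 4, pow_mul ‖x‖,
      pow_mul (1+w), hw, mul_pow]
    field_simp
  have e3 := key
  rw [funext e2] at e3
  have e4 := e3.tsum_eq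
  rw [tsum_mul_left, ← hyp2F1_eq] at e4
  rw [← quad_transform s _ hd' hw0 hw1, mul_left_comm, e4, ← integral_const_mul]
  apply integral_congr_ae
  refine .of_forall fun θ => ?_
  simp only
  have hu1 : 0 ≤ 1 - u θ := by
    have := (abs_le.1 (hub θ)).2; linarith
  rw [← mul_rpow hw2.le hu1]
  congr 1
  simp only [hu]
  field_simp


lemma beta_full {a b : ℝ} (ha : 0 < a) (hb : 0 < b) :
    Integrable (fun t : ℝ => if 0 < t ∧ t < 1 then t^(a-1)*(1-t)^(b-1) else 0) ∧
    ∫ t : ℝ, (if 0 < t ∧ t < 1 then t^(a-1)*(1-t)^(b-1) else 0) = realBeta a b := by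
  have hB : ProbabilityTheory.beta a b = realBeta a b := rfl
  have hBp := ProbabilityTheory.beta_pos ha hb
  have e : (fun t : ℝ => if 0 < t ∧ t < 1 then t^(a-1)*(1-t)^(b-1) else 0)
      = fun t => ProbabilityTheory.beta a b * ProbabilityTheory.betaPDFReal a b t := by
    ext t
    unfold ProbabilityTheory.betaPDFReal
    split_ifs
    · field_simp
    · simp
  have h1 := ProbabilityTheory.lintegral_betaPDF_eq_one ha hb
  have h0 : ∀ t, 0 ≤ ProbabilityTheory.betaPDFReal a b t := by
    intro t
    unfold ProbabilityTheory.betaPDFReal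
    split_ifs with h
    · have : 0 < 1 - t := by linarith [h.2]
      have := h.1
      positivity
    · exact le_rfl
  have h2 : Integrable (ProbabilityTheory.betaPDFReal a b) := by
    refine ⟨(ProbabilityTheory.measurable_betaPDFReal a b).aestronglyMeasurable, ?_⟩
    rw [hasFiniteIntegral_iff_ofReal (.of_forall h0)]
    have : (∫⁻ t, ENNReal.ofReal (ProbabilityTheory.betaPDFReal a b t)) = 1 := h1
    rw [this]; exact ENNReal.one_lt_top
  constructor
  · rw [e]; exact h2.const_mul _
  · rw [e, integral_const_mul, integral_eq_lintegral_of_nonneg_ae (.of_forall h0) h2.1]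
    have : (∫⁻ t, ENNReal.ofReal (ProbabilityTheory.betaPDFReal a b t)) = 1 := h1
    rw [this, hB]; simp

lemma radial {a b : ℝ} (ha : 0 < a) (hb : 0 < b) :
    IntegrableOn (fun r : ℝ => if r < 1 then r^(2*a-1)*(1-r^2)^(b-1) else 0) (Set.Ioi 0) ∧
    ∫ r in Set.Ioi (0:ℝ), (if r < 1 then r^(2*a-1)*(1-r^2)^(b-1) else 0) = realBeta a b / 2 := by
  obtain ⟨h1, h2⟩ := beta_full ha hb
  set g : ℝ → ℝ := fun t : ℝ => if 0 < t ∧ t < 1 then t^(a-1)*(1-t)^(b-1) else 0 with hg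
  have e : ∀ r ∈ Set.Ioi (0:ℝ), (|(2:ℝ)| * r^((2:ℝ)-1)) • g (r^(2:ℝ)) =
      2 * (if r < 1 then r^(2*a-1)*(1-r^2)^(b-1) else 0) := by
    intro r hr
    have hr' : 0 < r := hr
    have i1 : (0 < r^2 ∧ r^2 < 1) ↔ r < 1 := by
      constructor
      · rintro ⟨_, h⟩; by_contra h'; push Not at h'; nlinarith
      · intro h; exact ⟨by positivity, by nlinarith⟩
    simp only [hg, rpow_two, i1, smul_eq_mul]
    split_ifs
    · have h5 : r^(2*a-1) = r ^ ((2:ℝ)-1) * (r^2)^(a-1) := by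
        rw [← rpow_two, ← rpow_mul hr'.le, ← rpow_add hr']; congr 1; ring
      rw [abs_of_pos (by norm_num : (0:ℝ) < 2), h5]
      ring
    · simp
  have h3 := (integrableOn_Ioi_comp_rpow_iff g (two_ne_zero' ℝ)).2 h1.integrableOn
  have h4 := integral_comp_rpow_Ioi g (two_ne_zero' ℝ)
  rw [setIntegral_congr_fun measurableSet_Ioi e, integral_const_mul] at h4
  rw [integrableOn_congr_fun e measurableSet_Ioi] at h3
  constructor
  · have := h3.const_mul (1/2)
    refine this.congr (.of_forall fun r => ?_)
    simp only; ring
  · have h5 : ∫ y in Set.Ioi 0, g y = ∫ y, g y := by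
      rw [← integral_indicator measurableSet_Ioi]
      congr 1; ext t
      simp only [Set.indicator, Set.mem_Ioi, hg]
      split_ifs with h h' <;> tauto
    rw [h5, h2] at h4
    linarith

lemma realBeta_shift {a b : ℝ} (ha : 0 < a) (hb : 0 < b) (k : ℕ) :
    realBeta (a+k) b = realBeta a b * (poch a k / poch (a+b) k) := by
  unfold realBeta
  rw [Gamma_add_nat ha, show a + k + b = a + b + k by ring, Gamma_add_nat (add_pos ha hb)]
  have := (Real.Gamma_pos_of_pos (add_pos ha hb)).ne'
  have := (poch_pos (add_pos ha hb) k).ne'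
  field_simp

lemma radial_sum {a b c s m : ℝ} (ha : 0 < a) (hb : 0 < b) (hc : 0 < c) (hm0 : 0 ≤ m) (hm : m < 1) :
    ∫ r in Set.Ioi (0:ℝ), (if r < 1 then r^(2*a-1)*(1-r^2)^(b-1) else 0) * hyp2F1 s (a+b) c (m*r^2)
      = realBeta a b / 2 * hyp2F1 s a c m := by
  set h : ℝ → ℝ := fun r => (if r < 1 then r^(2*a-1)*(1-r^2)^(b-1) else 0) with hh
  obtain ⟨hI, hv⟩ := radial ha hb
  have hh0 : ∀ r ∈ Set.Ioi (0:ℝ), 0 ≤ h r := by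
    intro r (hr : 0 < r)
    simp only [hh]; split_ifs with h1
    · have : 0 ≤ 1 - r^2 := by nlinarith
      positivity
    · exact le_rfl
  have e : ∀ (k : ℕ), ∀ r ∈ Set.Ioi (0:ℝ), h r * (hco s (a+b) c k * (m*r^2)^k) =
      (hco s (a+b) c k * m^k) * (if r < 1 then r^(2*(a+k)-1)*(1-r^2)^(b-1) else 0) := by
    intro k r (hr : 0 < r)
    simp only [hh]
    split_ifs with h1
    · rw [mul_pow, ← pow_mul, show 2*(a+k)-1 = (2*a-1) + ((2*k:ℕ):ℝ) by push_cast; ring,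
        rpow_add hr, rpow_natCast]
      ring
    · simp
  have hak : ∀ k : ℕ, 0 < a + k := fun k => by positivity
  have hs := hco_summable s (a+b) c hc (z := m) (by rwa [abs_of_nonneg hm0])
  have hFI : ∀ k : ℕ, Integrable (fun r => h r * (hco s (a+b) c k * (m*r^2)^k)) (volume.restrict (Set.Ioi 0)) := by
    intro k
    have := ((radial (hak k) hb).1).const_mul (hco s (a+b) c k * m^k)
    exact (integrableOn_congr_fun (e k) measurableSet_Ioi).2 this
  have key := hasSum_integral_of_summable_integral_norm (μ := volume.restrict (Set.Ioi (0:ℝ)))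
    (F := fun (k : ℕ) (r : ℝ) => h r * (hco s (a+b) c k * (m*r^2)^k)) hFI
    (by
      refine Summable.of_nonneg_of_le (fun n => by positivity) (fun n => ?_)
        (hs.mul_right (∫ r in Set.Ioi (0:ℝ), h r))
      rw [← integral_const_mul]
      refine setIntegral_mono_on (hFI n).norm (hI.const_mul _) measurableSet_Ioi ?_
      intro r hr
      have h1 := hh0 r hr
      have hr' : 0 < r := hr
      rw [norm_mul, norm_eq_abs, abs_of_nonneg h1, mul_comm]
      by_cases hr1 : r < 1
      · apply mul_le_mul_of_nonneg_right _ h1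
        rw [norm_eq_abs, abs_mul, abs_mul]
        apply mul_le_mul_of_nonneg_left _ (abs_nonneg _)
        rw [abs_of_nonneg (by positivity), abs_of_nonneg (by positivity)]
        apply pow_le_pow_left₀ (by positivity)
        have : r^2 ≤ 1 := by nlinarith
        nlinarith
      · have : h r = 0 := by simp [hh, hr1]
        simp [this])
  have e2 : ∀ k : ℕ, ∫ r in Set.Ioi (0:ℝ), h r * (hco s (a+b) c k * (m*r^2)^k)
      = realBeta a b / 2 * (hco s a c k * m^k) := by
    intro k
    rw [setIntegral_congr_fun measurableSet_Ioi (e k), integral_const_mul, (radial (hak k) hb).2,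
      realBeta_shift ha hb]
    unfold hco
    have := (poch_pos (add_pos ha hb) k).ne'
    have := (poch_pos hc k).ne'
    field_simp
  rw [funext e2] at key
  have e3 := key.tsum_eq
  rw [tsum_mul_left, ← hyp2F1_eq] at e3
  rw [e3]
  apply setIntegral_congr_fun measurableSet_Ioi
  intro r hr
  simp only
  rw [tsum_mul_left, ← hyp2F1_eq]


lemma rpow_bound {Q lo hi t : ℝ} (h0 : 0 < lo) (h1 : lo ≤ Q) (h2 : Q ≤ hi) :
    Q^t ≤ lo^t + hi^t := by
  have hQ : 0 < Q := h0.trans_le h1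
  have hh : 0 < hi := hQ.trans_le h2
  rcases le_total 0 t with ht | ht
  · have := rpow_le_rpow hQ.le h2 ht
    have : 0 ≤ lo^t := by positivity
    linarith
  · have := rpow_le_rpow_of_nonpos h0 h1 ht
    have : 0 ≤ hi^t := by positivity
    linarith

/-- The quadratic form -/
noncomputable def QQ {d : ℕ} (x z : EE d) : ℝ := 1 + ‖x‖^2*‖z‖^2 - 2*inner ℝ x z

lemma QQ_cont {d : ℕ} (x : EE d) : Continuous (QQ x) := by unfold QQ; fun_prop

lemma QQ_bounds {d : ℕ} {x z : EE d} (hx : ‖x‖ < 1) (hz : ‖z‖ < 1) :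
    (1-‖x‖)^2 ≤ QQ x z ∧ QQ x z ≤ 4 := by
  unfold QQ
  have h := abs_le.1 (abs_real_inner_le_norm x z)
  have h1 : ‖x‖*‖z‖ ≤ ‖x‖ := by nlinarith [norm_nonneg x]
  have h2 := norm_nonneg x
  have h3 : 0 ≤ ‖x‖ * ‖z‖ := by positivity
  have h4 : ‖x‖^2*‖z‖^2 = (‖x‖*‖z‖)^2 := by ring
  rw [h4]
  constructor <;> nlinarith

lemma QQ_pos {d : ℕ} {x z : EE d} (hx : ‖x‖ < 1) (hz : ‖z‖ < 1) : 0 < QQ x z :=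
  lt_of_lt_of_le (by have := sub_pos.2 hx; positivity) (QQ_bounds hx hz).1

lemma G_eval {d : ℕ} (hd : 1 ≤ d) {a b : ℝ} (ha : 0 < a) (hb : 0 < b) (x : EE d) (hx : ‖x‖ < 1) :
    ∫ z in Metric.ball (0 : EE d) 1, ‖z‖^(2*a-d) * (1-‖z‖^2)^(b-1) * (QQ x z)^(-(a+b-1+(d:ℝ)/2))
      = π ^ ((d:ℝ)/2) / Real.Gamma ((d:ℝ)/2) * realBeta a b * hyp2F1 (a+b-1+(d:ℝ)/2) a ((d:ℝ)/2) (‖x‖^2) := by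
  have hd' : (0:ℝ) < (d:ℝ)/2 := by have : (0:ℝ) < d := by exact_mod_cast hd
                                   linarith
  set s := a+b-1+(d:ℝ)/2 with hs
  set h : ℝ → ℝ := fun r => if r < 1 then r^(2*a-d)*(1-r^2)^(b-1) else 0 with hh
  have hmeas : Measurable h := by
    refine Measurable.ite measurableSet_Iio (by fun_prop) (by fun_prop)
  have hrad : ∀ r ∈ Set.Ioi (0:ℝ), r^(d-1) * h r = if r < 1 then r^(2*a-1)*(1-r^2)^(b-1) else 0 := by
    intro r (hr : 0 < r)
    simp only [hh]
    split_ifs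
    · rw [← mul_assoc, ← rpow_natCast, ← rpow_add hr, Nat.cast_sub hd]
      congr 2; push_cast; ring
    · simp
  have hI : Integrable (fun r : Set.Ioi (0:ℝ) => h r) (nu d) := by
    rw [nu_integrable, integrableOn_congr_fun hrad measurableSet_Ioi]
    exact (radial ha hb).1
  rw [← integral_indicator measurableSet_ball, polar_integral hd]
  have e : ∀ p : Metric.sphere (0 : EE d) 1 × Set.Ioi (0:ℝ),
      (Metric.ball (0 : EE d) 1).indicator (fun z => ‖z‖^(2*a-d) * (1-‖z‖^2)^(b-1) * (QQ x z)^(-s)) ((p.2:ℝ) • (p.1 : EE d))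
      = h p.2 * (QQ x ((p.2:ℝ) • (p.1 : EE d)))^(-s) := by
    rintro ⟨θ, r, hr⟩
    have hr' : 0 < r := hr
    have hn : ‖r • (θ : EE d)‖ = r := by rw [norm_smul]; simp [hr'.le]
    simp only [Set.indicator, mem_ball_zero_iff, hn, hh]
    split_ifs <;> simp
  simp_rw [e]
  have hn : ∀ p : Metric.sphere (0 : EE d) 1 × Set.Ioi (0:ℝ), ‖(p.2:ℝ) • (p.1 : EE d)‖ = p.2 := by
    rintro ⟨θ, r, hr⟩
    have hr' : 0 < r := hr
    rw [norm_smul]; simp [hr'.le]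
  have hint : Integrable (fun p : Metric.sphere (0 : EE d) 1 × Set.Ioi (0:ℝ) =>
      h p.2 * (QQ x ((p.2:ℝ) • (p.1 : EE d)))^(-s)) ((sg d).prod (nu d)) := by
    have hb1 : Integrable (fun p : Metric.sphere (0 : EE d) 1 × Set.Ioi (0:ℝ) => 1 * h p.2) ((sg d).prod (nu d)) :=
      (integrable_const (1:ℝ)).mul_prod hI
    refine (hb1.const_mul (((1-‖x‖)^2)^(-s) + 4^(-s))).mono' ?_ (.of_forall fun p => ?_)
    · apply Measurable.aestronglyMeasurable
      have m1 : Measurable (fun p : Metric.sphere (0 : EE d) 1 × Set.Ioi (0:ℝ) => (p.2:ℝ) • (p.1 : EE d)) := by fun_prop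
      have m2 := (QQ_cont x).measurable.comp m1
      have m3 : Measurable (fun p : Metric.sphere (0 : EE d) 1 × Set.Ioi (0:ℝ) => (p.2:ℝ)) := by fun_prop
      exact (hmeas.comp m3).mul (m2.pow_const _)
    · have hp : (0:ℝ) < p.2 := p.2.2
      by_cases h1 : (p.2:ℝ) < 1
      · have q1 := QQ_bounds hx (z := (p.2:ℝ) • (p.1 : EE d)) (by rwa [hn])
        have q2 := QQ_pos hx (z := (p.2:ℝ) • (p.1 : EE d)) (by rwa [hn])
        have h0 : 0 ≤ h p.2 := by
          simp only [hh, h1, if_true]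
          have : 0 ≤ 1 - (p.2:ℝ)^2 := by nlinarith
          positivity
        rw [norm_of_nonneg (by positivity), one_mul, mul_comm]
        apply mul_le_mul_of_nonneg_right _ h0
        exact rpow_bound (by have := sub_pos.2 hx; positivity) q1.1 q1.2
      · have : h p.2 = 0 := by simp [hh, h1]
        simp [this]
  rw [integral_prod_symm _ hint]
  have e2 : ∀ r : Set.Ioi (0:ℝ), ∫ θ : Metric.sphere (0 : EE d) 1, h r * (QQ x ((r:ℝ) • (θ : EE d)))^(-s) ∂(sg d)
      = (fun r : ℝ => 2 * π ^ ((d:ℝ)/2) / Real.Gamma ((d:ℝ)/2) * (h r * hyp2F1 s (a+b) ((d:ℝ)/2) (‖x‖^2*r^2))) r := by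
    rintro ⟨r, hr⟩
    have hr' : 0 < r := hr
    simp only
    rw [integral_const_mul]
    by_cases h1 : r < 1
    · have := angular hd s r x hr'.le (by nlinarith [norm_nonneg x])
      rw [show s + 1 - (d:ℝ)/2 = a + b by rw [hs]; ring] at this
      have e3 : ∀ θ : Metric.sphere (0 : EE d) 1, QQ x (r • (θ : EE d)) = 1 + ‖x‖^2*r^2 - 2*r*inner ℝ x (θ : EE d) := by
        intro θ
        have := hn (θ, ⟨r, hr⟩)
        simp only at this
        rw [QQ, this, inner_smul_right]; ring
      simp_rw [e3]
      rw [this]; ring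
    · simp [hh, h1]
  simp_rw [e2]
  rw [nu_integral (fun r : ℝ => 2 * π ^ ((d:ℝ)/2) / Real.Gamma ((d:ℝ)/2) * (h r * hyp2F1 s (a+b) ((d:ℝ)/2) (‖x‖^2*r^2)))]
  have e4 : ∀ r ∈ Set.Ioi (0:ℝ), r ^ (d-1) * (2 * π ^ ((d:ℝ)/2) / Real.Gamma ((d:ℝ)/2) * (h r * hyp2F1 s (a+b) ((d:ℝ)/2) (‖x‖^2*r^2)))
     = 2 * π ^ ((d:ℝ)/2) / Real.Gamma ((d:ℝ)/2) * ((if r < 1 then r^(2*a-1)*(1-r^2)^(b-1) else 0) * hyp2F1 s (a+b) ((d:ℝ)/2) (‖x‖^2*r^2)) := by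
    intro r hr
    rw [← hrad r hr]; ring
  rw [setIntegral_congr_fun measurableSet_Ioi e4, integral_const_mul,
    radial_sum ha hb hd' (by positivity) (pow_lt_one₀ (norm_nonneg _) hx (by norm_num))]
  ring


section mobius
variable {d : ℕ}

lemma mob_facts {x z c : EE d} {n κ : ℝ} (hn : n = ‖x‖^2) (hn0 : 0 < n) (hc : c = n⁻¹ • x)
    (hQ : 0 < QQ x z) (hκ : κ = (1-n)/QQ x z) :
    ‖z-c‖^2 = QQ x z / n ∧ 1 - ‖κ • (z-c) + c‖^2 = κ * (1-‖z‖^2) ∧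
    ‖x - (κ • (z-c) + c)‖^2 = κ * (1-n) * ‖z‖^2 := by
  have hκQ : κ * QQ x z = 1 - n := by rw [hκ]; field_simp
  have hcc : ‖c‖^2 = 1/n := by
    rw [hc, norm_smul, mul_pow, ← hn]; simp; field_simp
  have hxc : inner ℝ x c = 1 := by
    rw [hc, inner_smul_right, real_inner_self_eq_norm_sq, ← hn]; field_simp
  have hzc : inner ℝ z c = inner ℝ x z / n := by
    rw [hc, inner_smul_right, real_inner_comm]; field_simp
  have h1 : ‖z-c‖^2 = QQ x z / n := by
    rw [norm_sub_sq_real, hcc, hzc, QQ, ← hn]; field_simp; ring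
  have h2 : inner ℝ (z-c) c = (inner ℝ x z - 1)/n := by
    rw [inner_sub_left, hzc, real_inner_self_eq_norm_sq, hcc]; ring
  have h3 : ‖κ • (z-c) + c‖^2 = κ^2 * (QQ x z / n) + 2*κ*((inner ℝ x z - 1)/n) + 1/n := by
    rw [norm_add_sq_real, norm_smul, mul_pow, h1, hcc, inner_smul_left, h2]
    simp; ring
  have h4 : 1 - ‖κ • (z-c) + c‖^2 = κ * (1-‖z‖^2) := by
    rw [h3]
    have : κ^2 * (QQ x z / n) = κ * (1-n)/n := by rw [← hκQ]; ring
    rw [this]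
    have e : QQ x z = 1 + n*‖z‖^2 - 2*inner ℝ x z := by rw [QQ, ← hn]
    have hi : inner ℝ x z = (1 + n*‖z‖^2 - QQ x z)/2 := by rw [e]; ring
    rw [hi]
    field_simp
    linear_combination hκQ
  refine ⟨h1, h4, ?_⟩
  have h5 : inner ℝ x (κ • (z-c) + c) = κ*(inner ℝ x z - 1) + 1 := by
    rw [inner_add_right, inner_smul_right, inner_sub_right, hxc]
  have h6 : ‖κ • (z-c) + c‖^2 = 1 - κ * (1-‖z‖^2) := by linarith
  rw [norm_sub_sq_real, h5, h6, ← hn]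
  have e : QQ x z = 1 + n*‖z‖^2 - 2*inner ℝ x z := by rw [QQ, ← hn]
  have hi : inner ℝ x z = (1 + n*‖z‖^2 - QQ x z)/2 := by rw [e]; ring
  rw [hi]
  linear_combination hκQ

lemma mobius (a b : ℝ) (x : EE d) (hx : ‖x‖ < 1) :
    ∫ y in Metric.ball (0 : EE d) 1, ‖x-y‖^(2*a-d) * (1-‖y‖^2)^(b-1)
      = (1-‖x‖^2)^(2*a+b-1) *
    ∫ z in Metric.ball (0 : EE d) 1, ‖z‖^(2*a-d) * (1-‖z‖^2)^(b-1) * (QQ x z)^(-(a+b-1+(d:ℝ)/2)) := by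
  rcases eq_or_ne x 0 with rfl | hx0
  · simp [QQ]
  set n := ‖x‖^2 with hn
  have hn0 : 0 < n := by have := norm_pos_iff.2 hx0; positivity
  have hn1 : n < 1 := pow_lt_one₀ (norm_nonneg _) hx (by norm_num)
  have hn2 : 0 < 1 - n := by linarith
  set c : EE d := n⁻¹ • x with hc
  set ρ := √((1-n)/n) with hρ
  have hρ0 : ρ ≠ 0 := (Real.sqrt_pos.2 (by positivity)).ne'
  have hρ2 : ρ^2 = (1-n)/n := Real.sq_sqrt (by positivity)
  set T := EuclideanGeometry.inversion c ρ with hT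
  have hfac : ∀ z ∈ Metric.ball (0 : EE d) 1, 0 < QQ x z ∧ z ≠ c ∧ (ρ / dist z c)^2 = (1-n)/QQ x z ∧
      1 - ‖T z‖^2 = (1-n)/QQ x z * (1-‖z‖^2) ∧ ‖x - T z‖^2 = (1-n)/QQ x z * (1-n) * ‖z‖^2 := by
    intro z hz
    have hz' : ‖z‖ < 1 := by simpa using hz
    have hQ := QQ_pos hx hz'
    obtain ⟨f1, f2, f3⟩ := mob_facts hn hn0 hc hQ rfl
    have hk : (ρ / dist z c)^2 = (1-n)/QQ x z := by
      rw [div_pow, dist_eq_norm, f1, hρ2]; field_simp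
    have hTz : T z = ((1-n)/QQ x z) • (z-c) + c := by
      rw [hT, EuclideanGeometry.inversion, hk]; simp
    refine ⟨hQ, ?_, hk, by rw [hTz]; exact f2, by rw [hTz]; exact f3⟩
    intro hzc
    rw [hzc, sub_self] at f1
    rw [hzc] at hQ
    have : 0 < QQ x c / n := by positivity
    rw [← f1] at this
    simp at this
  have hmaps : ∀ z ∈ Metric.ball (0 : EE d) 1, T z ∈ Metric.ball (0 : EE d) 1 := by
    intro z hz
    obtain ⟨hQ, -, -, f2, -⟩ := hfac z hz
    have hz' : ‖z‖ < 1 := by simpa using hz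
    have : 0 < (1-n)/QQ x z * (1-‖z‖^2) := by
      have : 0 < 1 - ‖z‖^2 := by nlinarith [norm_nonneg z]
      positivity
    rw [← f2] at this
    rw [mem_ball_zero_iff]
    nlinarith [norm_nonneg (T z)]
  have himg : T '' Metric.ball (0 : EE d) 1 = Metric.ball (0 : EE d) 1 := by
    ext y; constructor
    · rintro ⟨z, hz, rfl⟩; exact hmaps z hz
    · intro hy; exact ⟨T y, hmaps y hy, EuclideanGeometry.inversion_inversion c hρ0 y⟩
  have hder : ∀ z ∈ Metric.ball (0 : EE d) 1, HasFDerivWithinAt T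
      ((ρ / dist z c) ^ 2 • ((Submodule.span ℝ {z - c})ᗮ.reflection : EE d →L[ℝ] EE d)) (Metric.ball (0 : EE d) 1) z := by
    intro z hz
    exact (EuclideanGeometry.hasFDerivAt_inversion (hfac z hz).2.1).hasFDerivWithinAt
  have hchg := integral_image_eq_integral_abs_det_fderiv_smul (volume : Measure (EE d)) measurableSet_ball hder
    (EuclideanGeometry.inversion_injective c hρ0).injOn (fun y => ‖x-y‖^(2*a-d) * (1-‖y‖^2)^(b-1))
  rw [himg] at hchg
  rw [hchg, ← integral_const_mul]
  apply setIntegral_congr_fun measurableSet_ball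
  intro z hz
  obtain ⟨hQ, -, hk, f2, f3⟩ := hfac z hz
  have hz' : ‖z‖ < 1 := by simpa using hz
  have hm : 0 < 1 - ‖z‖^2 := by nlinarith [norm_nonneg z]
  have hdet : |((ρ / dist z c) ^ 2 • ((Submodule.span ℝ {z - c})ᗮ.reflection : EE d →L[ℝ] EE d)).det| = ((1-n)/QQ x z)^d := by
    rw [hk]
    unfold ContinuousLinearMap.det
    rw [ContinuousLinearMap.toLinearMap_smul, LinearMap.det_smul]
    have : LinearMap.det ((((Submodule.span ℝ {z - c})ᗮ.reflection : EE d →L[ℝ] EE d)) : EE d →ₗ[ℝ] EE d) =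
      (-1)^(Module.finrank ℝ ((Submodule.span ℝ {z - c})ᗮᗮ : Submodule ℝ (EE d))) := Submodule.det_reflection _
    rw [this]
    simp [abs_mul, abs_div, abs_of_pos hQ, abs_of_pos hn2]
  simp only
  rw [hdet, f2, smul_eq_mul]
  have h1 : ‖x - T z‖^(2*a-d) = ((1-n)/QQ x z * (1-n) * ‖z‖^2)^(a-d/2) := by
    rw [← f3, ← rpow_two, ← rpow_mul (norm_nonneg _)]; congr 1; ring
  have h2 : ‖z‖^(2*a-d) = (‖z‖^2)^(a-d/2) := by
    rw [← rpow_two, ← rpow_mul (norm_nonneg _)]; congr 1; ring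
  rw [h1, h2, mul_rpow (by positivity) (by positivity), mul_rpow (by positivity) (by positivity), mul_rpow (by positivity) (by positivity),
    div_rpow hn2.le hQ.le, div_rpow hn2.le hQ.le, div_pow, ← rpow_natCast (1-n), ← rpow_natCast (QQ x z)]
  rw [show 2*a+b-1 = d + (a-d/2) + (a-d/2) + (b-1) by ring, rpow_add hn2, rpow_add hn2, rpow_add hn2,
    show a+b-1+(d:ℝ)/2 = d + (a-d/2) + (b-1) by ring, rpow_neg hQ.le, rpow_add hQ, rpow_add hQ]
  field_simp

lemma interior1 (hd : 1 ≤ d) {a b : ℝ} (ha : 0 < a) (hb : 0 < b) (x : EE d) (hx : ‖x‖ < 1) :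
    ∫ y in Metric.ball (0 : EE d) 1, ‖x-y‖^(2*a-d) * (1-‖y‖^2)^(b-1)
      = π ^ ((d:ℝ)/2) / Real.Gamma ((d:ℝ)/2) * realBeta a b * hyp2F1 ((d:ℝ)/2-a) (-(a+b-1)) ((d:ℝ)/2) (‖x‖^2) := by
  have hd' : (0:ℝ) < (d:ℝ)/2 := by have : (0:ℝ) < d := by exact_mod_cast hd
                                   linarith
  rw [mobius a b x hx, G_eval hd ha hb x hx]
  have := euler_transform ((d:ℝ)/2-a) (-(a+b-1)) ((d:ℝ)/2) hd' (w := ‖x‖^2)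
    (by rw [abs_of_nonneg (by positivity)]; exact pow_lt_one₀ (norm_nonneg _) hx (by norm_num))
  rw [← this]
  rw [show (d:ℝ)/2 - ((d:ℝ)/2-a) - -(a+b-1) = 2*a+b-1 by ring, show (d:ℝ)/2 - ((d:ℝ)/2-a) = a by ring,
    show (d:ℝ)/2 - -(a+b-1) = a+b-1+(d:ℝ)/2 by ring]
  have hsym : hyp2F1 a (a+b-1+(d:ℝ)/2) ((d:ℝ)/2) (‖x‖^2) = hyp2F1 (a+b-1+(d:ℝ)/2) a ((d:ℝ)/2) (‖x‖^2) := by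
    unfold hyp2F1
    congr 1; ext k
    rw [mul_comm (Polynomial.eval a _)]
  rw [hsym]; ring

end mobius


section boundary
variable {d : ℕ}

lemma slice (hd : 1 ≤ d) {a b : ℝ} (ha : 0 < a) (hb : 0 < b) (k : ℕ) (hk : a + b - 1 = k) (h : ℝ) :
    IntegrableOn (fun r : ℝ => r^(d-1) * (if r < 2*h then r^(2*a-d)*(r*(2*h-r))^(b-1) else 0)) (Set.Ioi 0) ∧
    ∫ r in Set.Ioi (0:ℝ), r^(d-1) * (if r < 2*h then r^(2*a-d)*(r*(2*h-r))^(b-1) else 0)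
      = if 0 < h then (2*h)^(2*k) * realBeta (a+k) b else 0 := by
  by_cases hh : 0 < h
  swap
  · have e : ∀ r ∈ Set.Ioi (0:ℝ), r^(d-1) * (if r < 2*h then r^(2*a-d)*(r*(2*h-r))^(b-1) else 0) = 0 := by
      intro r (hr : 0 < r)
      rw [if_neg (by linarith), mul_zero]
    constructor
    · rw [integrableOn_congr_fun e measurableSet_Ioi]; exact integrableOn_zero
    · rw [setIntegral_congr_fun measurableSet_Ioi e, if_neg hh]; simp
  set L := 2*h with hL
  have hL0 : 0 < L := by positivity
  have hak : 0 < a + k := by positivity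
  obtain ⟨h1, h2⟩ := beta_full hak hb
  set g : ℝ → ℝ := fun t : ℝ => if 0 < t ∧ t < 1 then t^(a+k-1)*(1-t)^(b-1) else 0 with hg
  have e : ∀ r ∈ Set.Ioi (0:ℝ), r^(d-1) * (if r < L then r^(2*a-d)*(r*(L-r))^(b-1) else 0)
      = L^(2*(k:ℝ)-1) * g (L⁻¹ * r) := by
    intro r (hr : 0 < r)
    have i : (0 < L⁻¹ * r ∧ L⁻¹ * r < 1) ↔ r < L := by
      rw [inv_mul_lt_iff₀ hL0, mul_one]
      exact ⟨fun h => h.2, fun h => ⟨by positivity, h⟩⟩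
    simp only [hg, i]
    split_ifs with hr1
    · have h3 : 0 < L - r := by linarith
      have e1 : 1 - L⁻¹ * r = L⁻¹ * (L - r) := by field_simp
      rw [e1, mul_rpow hr.le h3.le, mul_rpow (by positivity) hr.le, mul_rpow (by positivity) h3.le,
        inv_rpow hL0.le, inv_rpow hL0.le]
      have e2 : L^(2*(k:ℝ)-1) = L^(a+k-1) * L^(b-1) := by
        rw [← rpow_add hL0]; congr 1; rw [← hk]; ring
      have e3 : r^(a+k-1) = r^(d-1) * r^(2*a-d) * r^(b-1) := by
        rw [← rpow_natCast, ← rpow_add hr, ← rpow_add hr, Nat.cast_sub hd]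
        congr 1; rw [← hk]; push_cast; ring
      rw [e2, e3]
      have := (rpow_pos_of_pos hL0 (a+k-1)).ne'
      have := (rpow_pos_of_pos hL0 (b-1)).ne'
      field_simp
    · simp
  have hz : ∀ r, r ∉ Set.Ioi (0:ℝ) → g (L⁻¹ * r) = 0 := by
    intro r hr
    have hr' : r ≤ 0 := by simpa using hr
    have : ¬ (0 < L⁻¹ * r) := by
      have : 0 < L⁻¹ := by positivity
      nlinarith
    simp [hg, this]
  constructor
  · rw [integrableOn_congr_fun e measurableSet_Ioi]
    exact ((h1.comp_mul_left' (inv_pos.2 hL0).ne').const_mul _).integrableOn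
  · rw [setIntegral_congr_fun measurableSet_Ioi e, integral_const_mul,
      setIntegral_eq_integral_of_forall_compl_eq_zero hz, Measure.integral_comp_mul_left g, h2, if_pos hh, inv_inv,
      abs_of_pos hL0, smul_eq_mul, ← mul_assoc]
    congr 1
    rw [← rpow_add_one hL0.ne', ← rpow_natCast]
    congr 1; push_cast; ring

lemma bdd_sphere (f : EE d → ℝ) (hf : Measurable f) (C : ℝ) (hC : ∀ z, ‖z‖ = 1 → |f z| ≤ C) :
    Integrable (fun θ : Metric.sphere (0 : EE d) 1 => f θ) (sg d) := by
  refine (integrable_const C).mono' (hf.comp measurable_subtype_coe).aestronglyMeasurable (.of_forall fun θ => ?_)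
  exact hC θ (by simp)

lemma half_moment (hd : 1 ≤ d) (k : ℕ) (x : EE d) (hx : ‖x‖ = 1) :
    Integrable (fun θ : Metric.sphere (0 : EE d) 1 => if 0 < inner ℝ x (θ : EE d) then (inner ℝ x (θ : EE d))^(2*k) else 0) (sg d) ∧
    ∫ θ : Metric.sphere (0 : EE d) 1, (if 0 < inner ℝ x (θ : EE d) then (inner ℝ x (θ : EE d))^(2*k) else 0) ∂(sg d)
     = π ^ ((d:ℝ)/2) / Real.Gamma ((d:ℝ)/2) * (poch (1/2) k / poch ((d:ℝ)/2) k) := by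
  have hd' : (0:ℝ) < d := by exact_mod_cast hd
  have g1 := (Real.Gamma_pos_of_pos (s := (((2*k:ℕ):ℝ)+d)/2) (by positivity)).ne'
  set gp : EE d → ℝ := fun z => if 0 < inner ℝ x z then (inner ℝ x z)^(2*k) else 0 with hgp
  set gm : EE d → ℝ := fun z => if inner ℝ x z < 0 then (inner ℝ x z)^(2*k) else 0 with hgm
  set g0 : EE d → ℝ := fun z => if inner ℝ x z = 0 then (inner ℝ x z)^(2*k) else 0 with hg0
  have mi : Measurable (fun z : EE d => inner ℝ x z) := by fun_prop
  have mp : Measurable gp := Measurable.ite (measurableSet_lt measurable_const mi) (by fun_prop) (by fun_prop)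
  have mm : Measurable gm := Measurable.ite (measurableSet_lt mi measurable_const) (by fun_prop) (by fun_prop)
  have m0 : Measurable g0 := Measurable.ite (measurableSet_eq_fun mi measurable_const) (by fun_prop) (by fun_prop)
  have bd : ∀ z : EE d, ‖z‖ = 1 → |(inner ℝ x z)^(2*k)| ≤ 1 := by
    intro z hz
    rw [abs_pow]
    apply pow_le_one₀ (abs_nonneg _)
    have := abs_real_inner_le_norm x z
    rwa [hx, hz, one_mul] at this
  have ip : Integrable (fun θ : Metric.sphere (0 : EE d) 1 => gp θ) (sg d) := bdd_sphere gp mp 1 (by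
    intro z hz; simp only [hgp]; split_ifs; exacts [bd z hz, by simp])
  have im : Integrable (fun θ : Metric.sphere (0 : EE d) 1 => gm θ) (sg d) := bdd_sphere gm mm 1 (by
    intro z hz; simp only [hgm]; split_ifs; exacts [bd z hz, by simp])
  have i0 : Integrable (fun θ : Metric.sphere (0 : EE d) 1 => g0 θ) (sg d) := bdd_sphere g0 m0 1 (by
    intro z hz; simp only [hg0]; split_ifs; exacts [bd z hz, by simp])
  refine ⟨ip, ?_⟩
  have Gp := sphere_gauss hd (2*k) gp (by
    intro r z hr
    simp only [hgp, inner_smul_right, mul_pos_iff_of_pos_left hr]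
    split_ifs <;> simp [mul_pow])
  have Gm := sphere_gauss hd (2*k) gm (by
    intro r z hr
    have : r * inner ℝ x z < 0 ↔ inner ℝ x z < 0 := by
      constructor
      · intro h; by_contra h'; push Not at h'; have := mul_nonneg hr.le h'; linarith
      · intro h; exact mul_neg_of_pos_of_neg hr h
    simp only [hgm, inner_smul_right, this]
    split_ifs <;> simp [mul_pow])
  have G0 := sphere_gauss hd (2*k) g0 (by
    intro r z hr
    simp only [hg0, inner_smul_right, mul_eq_zero, hr.ne', false_or]
    split_ifs <;> simp [mul_pow])
  have hsym : ∫ z, gp z * exp (-‖z‖^2) = ∫ z, gm z * exp (-‖z‖^2) := by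
    rw [← integral_neg_eq_self (fun z => gm z * exp (-‖z‖^2)) volume]
    congr 1; ext z
    simp only [hgp, hgm, inner_neg_right, norm_neg, Left.neg_neg_iff, Even.neg_pow (even_two_mul k)]
  have hnull : ∫ z, g0 z * exp (-‖z‖^2) = 0 := by
    have hs : (volume : Measure (EE d)) ((Submodule.span ℝ {x})ᗮ : Submodule ℝ (EE d)) = 0 := by
      apply Measure.addHaar_submodule
      intro ht
      have : x ∈ (Submodule.span ℝ {x})ᗮ := by rw [ht]; trivial
      rw [Submodule.mem_orthogonal_singleton_iff_inner_right, real_inner_self_eq_norm_sq, hx] at this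
      norm_num at this
    have : ∀ᵐ z : EE d, g0 z * exp (-‖z‖^2) = 0 := by
      have h1 : ∀ᵐ z : EE d, z ∉ (((Submodule.span ℝ {x})ᗮ : Submodule ℝ (EE d)) : Set (EE d)) := measure_eq_zero_iff_ae_notMem.1 hs
      filter_upwards [h1] with z hz
      have : inner ℝ x z ≠ 0 := fun h => hz (Submodule.mem_orthogonal_singleton_iff_inner_right.2 h)
      simp [hg0, this]
    rw [integral_congr_ae this]; simp
  rw [hnull] at G0
  rw [hsym, Gm] at Gp
  have hpos : Real.Gamma (((2*k:ℕ):ℝ)/2 + d/2)/2 ≠ 0 := by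
    rw [← add_div]
    positivity
  have E1 : ∫ θ : Metric.sphere (0 : EE d) 1, gm θ ∂(sg d) = ∫ θ : Metric.sphere (0 : EE d) 1, gp θ ∂(sg d) := by
    apply mul_right_cancel₀ hpos
    rw [← add_div]; exact Gp
  have E0 : ∫ θ : Metric.sphere (0 : EE d) 1, g0 θ ∂(sg d) = 0 := by
    apply mul_right_cancel₀ hpos
    rw [← add_div, zero_mul]; exact G0.symm
  have M := sphere_moment hd k x
  have dec : ∀ θ : Metric.sphere (0 : EE d) 1, (inner ℝ x (θ : EE d))^(2*k) = gp θ + gm θ + g0 θ := by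
    intro θ
    simp only [hgp, hgm, hg0]
    rcases lt_trichotomy (inner ℝ x (θ : EE d)) 0 with h | h | h
    · simp [h, h.not_gt, h.ne]
    · simp [h]
    · simp [h, h.not_gt, h.ne']
  simp_rw [dec] at M
  have ipm : Integrable (fun θ : Metric.sphere (0 : EE d) 1 => gp θ + gm θ) (sg d) := ip.add im
  rw [integral_add ipm i0, integral_add ip im, E1, E0, hx] at M
  simp only [one_pow, one_mul, add_zero] at M
  linear_combination M / 2

lemma poch_neg_nat (k j : ℕ) : poch (-(k:ℝ)) j = (-1)^j * (k.choose j) * j.factorial := by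
  induction j with
  | zero => simp [poch_zero]
  | succ j ih =>
    rw [poch_succ, ih, Nat.factorial_succ]
    have h := Nat.choose_succ_right_eq k j
    rcases le_or_gt j k with hj | hj
    · have h' : (k.choose (j+1) : ℝ) * (j+1) = k.choose j * (k - j) := by
        rw [← Nat.cast_sub hj]; exact_mod_cast h
      push_cast
      rw [pow_succ]
      linear_combination (-1)^j * (j.factorial : ℝ) * h'
    · rw [Nat.choose_eq_zero_of_lt hj, Nat.choose_eq_zero_of_lt (by omega)]; simp

lemma hyp_one (k : ℕ) (a c : ℝ) (hc : 0 < c) : hyp2F1 (c-a) (-(k:ℝ)) c 1 = poch a k / poch c k := by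
  have v := vand1 k (c-a) c hc
  rw [show c - (c-a) = a by ring] at v
  rw [← v, hyp2F1_eq, tsum_eq_sum (s := Finset.range (k+1))]
  · apply Finset.sum_congr rfl
    intro j _
    rw [hco, poch_neg_nat, one_pow, mul_one]
    have := (poch_pos hc j).ne'
    field_simp
  · intro j hj
    rw [hco, poch_neg_of_gt (by simpa using hj)]; simp

lemma boundary1 (hd : 1 ≤ d) {a b : ℝ} (ha : 0 < a) (hb : 0 < b) (k : ℕ) (hk : a + b - 1 = k)
    (x : EE d) (hx : ‖x‖ = 1) :
    ∫ y in Metric.ball (0 : EE d) 1, ‖x-y‖^(2*a-d) * (1-‖y‖^2)^(b-1)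
      = π ^ ((d:ℝ)/2) / Real.Gamma ((d:ℝ)/2) * realBeta a b * hyp2F1 ((d:ℝ)/2-a) (-(a+b-1)) ((d:ℝ)/2) (‖x‖^2) := by
  have hd' : (0:ℝ) < (d:ℝ)/2 := by have : (0:ℝ) < d := by exact_mod_cast hd
                                   linarith
  rw [hx, one_pow, hk, hyp_one k a _ hd']
  rw [← integral_indicator measurableSet_ball, ← integral_sub_left_eq_self _ volume x, polar_integral hd]
  set f : ℝ → ℝ → ℝ := fun h r => if r < 2*h then r^(2*a-d)*(r*(2*h-r))^(b-1) else 0 with hf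
  have e : ∀ p : Metric.sphere (0 : EE d) 1 × Set.Ioi (0:ℝ),
      (Metric.ball (0 : EE d) 1).indicator (fun y => ‖x-y‖^(2*a-d) * (1-‖y‖^2)^(b-1)) (x - (p.2:ℝ) • (p.1 : EE d))
      = f (inner ℝ x (p.1 : EE d)) p.2 := by
    rintro ⟨θ, r, hr⟩
    have hr' : 0 < r := hr
    have hn : ‖r • (θ : EE d)‖ = r := by rw [norm_smul]; simp [hr'.le]
    have hn2 : 1 - ‖x - r • (θ : EE d)‖^2 = r*(2*inner ℝ x (θ : EE d) - r) := by
      rw [norm_sub_sq_real, hn, hx, inner_smul_right]; ring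
    have hiff : ‖x - r • (θ : EE d)‖ < 1 ↔ r < 2*inner ℝ x (θ : EE d) := by
      have h1 : ‖x - r • (θ : EE d)‖ < 1 ↔ 0 < 1 - ‖x - r • (θ : EE d)‖^2 := by
        constructor <;> intro h <;> nlinarith [norm_nonneg (x - r • (θ : EE d))]
      rw [h1, hn2, mul_pos_iff_of_pos_left hr', sub_pos]
    simp only [Set.indicator, mem_ball_zero_iff, hf, hiff, hn2, sub_sub_cancel, hn]
  simp_rw [e]
  have hsl : ∀ h, Integrable (fun r : Set.Ioi (0:ℝ) => f h r) (nu d) ∧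
      ∫ r : Set.Ioi (0:ℝ), f h r ∂(nu d) = if 0 < h then (2*h)^(2*k) * realBeta (a+k) b else 0 := by
    intro h
    obtain ⟨s1, s2⟩ := slice hd ha hb k hk h
    exact ⟨(nu_integrable (f h)).2 s1, by rw [nu_integral (f h)]; exact s2⟩
  have hfm : Measurable (fun q : ℝ × ℝ => f q.1 q.2) := by
    refine Measurable.ite (measurableSet_lt measurable_snd (measurable_fst.const_mul 2)) ?_ measurable_const
    exact (measurable_snd.pow_const _).mul ((measurable_snd.mul ((measurable_fst.const_mul 2).sub measurable_snd)).pow_const _)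
  obtain ⟨H1, H2⟩ := half_moment hd k x hx
  have e5 : ∀ h : ℝ, (if 0 < h then (2*h)^(2*k) * realBeta (a+k) b else 0)
      = 4^k * realBeta (a+k) b * (if 0 < h then h^(2*k) else 0) := by
    intro h
    split_ifs
    · rw [mul_pow, pow_mul 2 2 k]; norm_num; ring
    · simp
  have hf0 : ∀ (h : ℝ), ∀ r : Set.Ioi (0:ℝ), 0 ≤ f h r := by
    intro h r
    have : (0:ℝ) < r := r.2
    simp only [hf]
    split_ifs with h1
    · have : 0 < 2*h - r := by linarith
      positivity
    · exact le_rfl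
  clear_value f
  have hint : Integrable (fun p : Metric.sphere (0 : EE d) 1 × Set.Ioi (0:ℝ) => f (inner ℝ x (p.1 : EE d)) p.2) ((sg d).prod (nu d)) := by
    rw [integrable_prod_iff]
    · refine ⟨Filter.Eventually.of_forall fun θ => (hsl (inner ℝ x (θ : EE d))).1, ?_⟩
      have : ∀ θ : Metric.sphere (0 : EE d) 1, ∫ r : Set.Ioi (0:ℝ), ‖f (inner ℝ x (θ : EE d)) r‖ ∂(nu d)
          = 4^k * realBeta (a+k) b * (if 0 < inner ℝ x (θ : EE d) then (inner ℝ x (θ : EE d))^(2*k) else 0) := by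
        intro θ
        simp_rw [norm_of_nonneg (hf0 _ _)]
        rw [(hsl _).2, e5]
      simp_rw [this]
      exact H1.const_mul _
    · apply Measurable.aestronglyMeasurable
      have m1 : Measurable (fun p : Metric.sphere (0 : EE d) 1 × Set.Ioi (0:ℝ) => inner ℝ x (p.1 : EE d)) := by fun_prop
      have m2 : Measurable (fun p : Metric.sphere (0 : EE d) 1 × Set.Ioi (0:ℝ) => (p.2 : ℝ)) := by fun_prop
      exact hfm.comp (m1.prodMk m2)
  rw [integral_prod _ hint]
  simp only
  simp_rw [(hsl _).2, e5]
  rw [integral_const_mul, H2, realBeta_shift ha hb, show a + b = 1 + k by linarith]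
  have h1 : poch 1 (2*k) = poch 1 k * poch (1+k) k := by rw [two_mul, poch_add]
  rw [poch_one, poch_one, fact_two_mul] at h1
  have h2 : poch (1+(k:ℝ)) k = 4^k * poch (1/2) k := by
    have : (k.factorial : ℝ) ≠ 0 := by positivity
    apply mul_left_cancel₀ this
    linear_combination -h1
  rw [h2]
  have := (poch_pos (a := 1/2) (by norm_num) k).ne'
  field_simp

end boundary


lemma full1 {d : ℕ} (hd : 1 ≤ d) {a b : ℝ} (ha : 0 < a) (hb : 0 < b)
    (x : EE d) (hx : ‖x‖ < 1 ∨ (∃ k : ℕ, a + b - 1 = k) ∧ ‖x‖ ≤ 1) :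
    ∫ y in Metric.ball (0 : EE d) 1, ‖x-y‖^(2*a-d) * (1-‖y‖^2)^(b-1)
      = π ^ ((d:ℝ)/2) / Real.Gamma ((d:ℝ)/2) * realBeta a b * hyp2F1 ((d:ℝ)/2-a) (-(a+b-1)) ((d:ℝ)/2) (‖x‖^2) := by
  rcases hx with hx | ⟨⟨k, hk⟩, hx⟩
  · exact interior1 hd ha hb x hx
  · rcases hx.lt_or_eq with hx | hx
    · exact interior1 hd ha hb x hx
    · exact boundary1 hd ha hb k hk x hx

lemma scaled {d : ℕ} (hd : 1 ≤ d) (R : ℝ) (hR : 0 < R) (ℓ α : ℝ)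
    (hα1 : -(d : ℝ) < α) (hα2 : α < 2 + 2 * ℓ - d) (x : EE d)
    (hx : ‖x‖ < R ∨ (∃ k : ℕ, ℓ = k) ∧ ‖x‖ ≤ R) :
    ∫ y in Metric.closedBall (0 : EE d) R,
          ‖x - y‖ ^ α * (R ^ 2 - ‖y‖ ^ 2) ^ (ℓ - (α + d) / 2)
        = Real.pi ^ ((d : ℝ) / 2) * R ^ (2 * ℓ) / Real.Gamma ((d : ℝ) / 2) *
            realBeta ((α + d) / 2) ((2 * ℓ + 2 - α - d) / 2) *
            hyp2F1 (-α / 2) (-ℓ) ((d : ℝ) / 2) (‖x‖ ^ 2 / R ^ 2) := by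
  set x' : EE d := R⁻¹ • x with hx'
  have hxx : x = R • x' := by rw [hx', smul_smul, mul_inv_cancel₀ hR.ne', one_smul]
  have hnx : ‖x'‖ = ‖x‖ / R := by rw [hx', norm_smul, norm_inv, norm_of_nonneg hR.le]; field_simp
  have F := full1 hd (a := (α+d)/2) (b := (2*ℓ+2-α-d)/2) (by linarith) (by linarith) x' (by
    rw [hnx, div_lt_one hR, div_le_one hR]
    rcases hx with hx | ⟨⟨k, hk⟩, hx⟩
    · exact Or.inl hx
    · exact Or.inr ⟨⟨k, by rw [← hk]; ring⟩, hx⟩)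
  rw [show 2*((α+d)/2) - d = α by ring, show (2*ℓ+2-α-d)/2 - 1 = ℓ - (α+d)/2 by ring,
    show (d:ℝ)/2 - (α+d)/2 = -α/2 by ring, show (α+d)/2 + (2*ℓ+2-α-d)/2 - 1 = ℓ by ring, hnx, div_pow] at F
  have hae : (Metric.closedBall (0 : EE d) R) =ᵐ[volume] Metric.ball (0 : EE d) R := by
    have : Metric.closedBall (0 : EE d) R = Metric.ball 0 R ∪ Metric.sphere 0 R := Metric.ball_union_sphere.symm
    rw [this]
    exact union_ae_eq_left_of_ae_eq_empty (ae_eq_empty.2 (Measure.addHaar_sphere_of_ne_zero volume 0 hR.ne'))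
  rw [setIntegral_congr_set hae]
  have hsc := Measure.setIntegral_comp_smul_of_pos (volume : Measure (EE d))
    (fun y => ‖x - y‖ ^ α * (R ^ 2 - ‖y‖ ^ 2) ^ (ℓ - (α + d) / 2)) (Metric.ball 0 1) hR
  rw [smul_unitBall_of_pos hR, finrank_euclideanSpace_fin, smul_eq_mul] at hsc
  have e : ∀ y ∈ Metric.ball (0 : EE d) 1, ‖x - R • y‖ ^ α * (R ^ 2 - ‖R • y‖ ^ 2) ^ (ℓ - (α + d) / 2)
      = (R^α * (R^2)^(ℓ - (α + d) / 2)) * (‖x' - y‖ ^ α * (1 - ‖y‖ ^ 2) ^ (ℓ - (α + d) / 2)) := by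
    intro y hy
    have hy' : ‖y‖ < 1 := by simpa using hy
    have hm : 0 ≤ 1 - ‖y‖^2 := by nlinarith [norm_nonneg y]
    rw [hxx, ← smul_sub, norm_smul, norm_smul, norm_of_nonneg hR.le, mul_rpow hR.le (norm_nonneg _),
      show R^2 - (R*‖y‖)^2 = R^2*(1-‖y‖^2) by ring, mul_rpow (by positivity) hm]
    ring
  rw [setIntegral_congr_fun measurableSet_ball e, integral_const_mul, F] at hsc
  have hRd : R^d ≠ 0 := by positivity
  rw [eq_inv_mul_iff_mul_eq₀ hRd] at hsc
  rw [← hsc]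
  have e2 : R ^ (2*ℓ) = R^d * (R^α * (R^2)^(ℓ - (α + d) / 2)) := by
    rw [← rpow_two, ← rpow_mul hR.le, ← rpow_natCast, ← rpow_add hR, ← rpow_add hR]
    congr 1; ring
  rw [e2]; ring

/-- For real `ℓ` and `−d < α < 2 + 2ℓ − d`, for every `|x| < R`,
`∫_{B_R} |x − y|^α (R² − |y|²)^{ℓ−(α+d)/2} dy
  = (π^{d/2} R^{2ℓ}/Γ(d/2)) B((α+d)/2,(2ℓ+2−α−d)/2) ₂F₁(−α/2,−ℓ;d/2;|x|²/R²)`;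
if in addition `ℓ ∈ ℕ`, the identity holds for all `|x| ≤ R`. -/
theorem stmt3 (d : ℕ) (hd : 1 ≤ d) (R : ℝ) (hR : 0 < R) (ℓ α : ℝ)
    (hα1 : -(d : ℝ) < α) (hα2 : α < 2 + 2 * ℓ - d) :
    (∀ x : EuclideanSpace ℝ (Fin d), ‖x‖ < R →
      ∫ y in Metric.closedBall (0 : EuclideanSpace ℝ (Fin d)) R,
          ‖x - y‖ ^ α * (R ^ 2 - ‖y‖ ^ 2) ^ (ℓ - (α + d) / 2)
        = Real.pi ^ ((d : ℝ) / 2) * R ^ (2 * ℓ) / Real.Gamma ((d : ℝ) / 2) *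
            realBeta ((α + d) / 2) ((2 * ℓ + 2 - α - d) / 2) *
            hyp2F1 (-α / 2) (-ℓ) ((d : ℝ) / 2) (‖x‖ ^ 2 / R ^ 2)) ∧
    ((∃ k : ℕ, ℓ = k) → ∀ x : EuclideanSpace ℝ (Fin d), ‖x‖ ≤ R →
      ∫ y in Metric.closedBall (0 : EuclideanSpace ℝ (Fin d)) R,
          ‖x - y‖ ^ α * (R ^ 2 - ‖y‖ ^ 2) ^ (ℓ - (α + d) / 2)
        = Real.pi ^ ((d : ℝ) / 2) * R ^ (2 * ℓ) / Real.Gamma ((d : ℝ) / 2) *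
            realBeta ((α + d) / 2) ((2 * ℓ + 2 - α - d) / 2) *
            hyp2F1 (-α / 2) (-ℓ) ((d : ℝ) / 2) (‖x‖ ^ 2 / R ^ 2)) := by
  exact ⟨fun x hx => scaled hd R hR ℓ α hα1 hα2 x (Or.inl hx),
    fun hk x hx => scaled hd R hR ℓ α hα1 hα2 x (Or.inr ⟨hk, hx⟩)⟩
end
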